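/- Let m ∈ ℕ. Suppose a, b ∈ ℝ are such that log( (1/(2π²)) ∫_{S³} e^{3(f - f̄)} dμ_{S³} ) ≤ a [ ∫_{𝔹⁴} (Δu)² dx + 2 ∫_{S³} |∇f|²_{S³} dμ_{S³} ] + b holds for every u ∈ H²(𝔹⁴) satisfying the boundary conditions u = f and ∂u/∂r = 0 on S³ and such that ∫_{S³} p e^{3f} dμ_{S³} = 0 for all p ∈ P̊_m, where f̄ = (1/(2π²)) ∫_{S³} f dμ_{S³}. Then a ≥ 3/(16π² N_m(S³)). -/

import Mathlib

open MeasureTheory Metric Filter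
open scoped ENNReal RealInnerProductSpace

noncomputable section

abbrev E (n : ℕ) : Type := EuclideanSpace ℝ (Fin n)

/-- The standard surface measure on the unit sphere `S^{n-1}`, as a Borel measure on `ℝⁿ`. -/
def sphMeasure (n : ℕ) : Measure (E n) :=
  Measure.map Subtype.val ((volume : Measure (E n)).toSphere)

/-- `P̊_m` : polynomials of degree at most `m` with zero mean on the sphere. -/
def P0 (n m : ℕ) : Set (MvPolynomial (Fin n) ℝ) :=
  {p | p.totalDegree ≤ m ∧ ∫ x, MvPolynomial.eval (fun i => x i) p ∂(sphMeasure n) = 0}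

/-- `N_m(S^{n-1})` : the smallest `N` for which there are `N` points on the sphere and
nonnegative weights summing to `1` whose weighted sums annihilate every `p ∈ P̊_m`. -/
def Nsph (n m : ℕ) : ℕ :=
  sInf {N : ℕ | ∃ (x : Fin N → E n) (w : Fin N → ℝ),
    (∀ i, x i ∈ Metric.sphere (0 : E n) 1) ∧ (∀ i, 0 ≤ w i) ∧ (∑ i, w i) = 1 ∧
    ∀ p ∈ P0 n m, (∑ i, w i * MvPolynomial.eval (fun j => x i j) p) = 0}

/-- The Euclidean Laplacian `Δu = Σ_i ∂²u/∂x_i²`. -/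
def lap (n : ℕ) (u : E n → ℝ) (x : E n) : ℝ :=
  ∑ i : Fin n, fderiv ℝ (fun y => fderiv ℝ u y (EuclideanSpace.single i 1)) x
    (EuclideanSpace.single i 1)

/-- `|∇f|²_{S^{n-1}}` at a point `x` of the unit sphere: the squared norm of the tangential
gradient, i.e. `‖∇f‖² - ⟨∇f, x⟩²`. -/
def tgradNormSq (n : ℕ) (f : E n → ℝ) (x : E n) : ℝ :=
  ‖gradient f x‖ ^ 2 - (fderiv ℝ f x x) ^ 2

/-- The truncated cone over a set of directions. -/
def coneOver (s : Set (E 4)) : Set (E 4) := {x | 0 < ‖x‖ ∧ ‖x‖ < 1 ∧ ‖x‖⁻¹ • x ∈ s}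

open scoped Pointwise in
lemma sph_apply {s : Set (E 4)} (hs : MeasurableSet s) :
    sphMeasure 4 s = 4 * volume (coneOver s) := by
  rw [sphMeasure, Measure.map_apply measurable_subtype_coe hs,
    Measure.toSphere_apply' _ (measurable_subtype_coe hs)]
  have h1 : Set.Ioo (0:ℝ) 1 • (Subtype.val '' ((Subtype.val : sphere (0 : E 4) 1 → E 4) ⁻¹' s)) = coneOver s := by
    ext x
    simp only [Set.mem_smul, coneOver, Set.mem_ofPred_eq, Set.mem_image, Set.mem_preimage]
    constructor
    · rintro ⟨r, hr, _, ⟨⟨y, hy⟩, hys, rfl⟩, rfl⟩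
      have hy1 : ‖y‖ = 1 := by simpa using hy
      have hn : ‖r • y‖ = r := by rw [norm_smul, hy1, mul_one, Real.norm_of_nonneg hr.1.le]
      refine ⟨by rw [hn]; exact hr.1, by rw [hn]; exact hr.2, ?_⟩
      rw [hn, smul_smul, inv_mul_cancel₀ hr.1.ne', one_smul]
      exact hys
    · rintro ⟨h0, h1, h2⟩
      refine ⟨‖x‖, ⟨h0, h1⟩, ‖x‖⁻¹ • x, ⟨⟨‖x‖⁻¹ • x, ?_⟩, h2, rfl⟩, ?_⟩
      · simp [norm_smul, h0.ne']
      · rw [smul_smul, mul_inv_cancel₀ h0.ne', one_smul]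
  rw [h1]
  simp

instance : IsFiniteMeasure (sphMeasure 4) := by
  unfold sphMeasure; infer_instance

lemma sph_ae : ∀ᵐ x ∂(sphMeasure 4), ‖x‖ = 1 := by
  unfold sphMeasure
  rw [ae_map_iff measurable_subtype_coe.aemeasurable
    (measurableSet_eq_fun measurable_norm measurable_const)]
  filter_upwards with x
  simp

lemma sph_inv (U : E 4 ≃ₗᵢ[ℝ] E 4) : MeasurePreserving U (sphMeasure 4) (sphMeasure 4) := by
  refine ⟨U.continuous.measurable, ?_⟩
  ext s hs
  rw [Measure.map_apply U.continuous.measurable hs, sph_apply hs,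
    sph_apply (U.continuous.measurable hs)]
  congr 1
  rw [← U.measurePreserving.measure_preimage_equiv (f := U.toHomeomorph.toMeasurableEquiv) (coneOver s)]
  congr 1
  ext x
  simp [coneOver]

lemma sph_inv_integral (U : E 4 ≃ₗᵢ[ℝ] E 4) (F : E 4 → ℝ) :
    ∫ x, F (U x) ∂(sphMeasure 4) = ∫ x, F x ∂(sphMeasure 4) :=
  (sph_inv U).integral_comp U.toHomeomorph.measurableEmbedding F

lemma vol_ball4 : (volume : Measure (E 4)).real (ball 0 1) = Real.pi ^ 2 / 2 := by
  rw [measureReal_def, EuclideanSpace.volume_ball]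
  have : Real.Gamma ((4:ℝ) / 2 + 1) = 2 := by
    rw [show (4:ℝ)/2 + 1 = ((2:ℕ):ℝ) + 1 by norm_num, Real.Gamma_nat_eq_factorial]; norm_num
  have h2 : Real.sqrt Real.pi ^ 4 = Real.pi ^ 2 := by
    rw [show Real.sqrt Real.pi ^ 4 = (Real.sqrt Real.pi ^ 2) ^ 2 by ring, Real.sq_sqrt Real.pi_pos.le]
  simp [this, h2]
  positivity

lemma sph_univ : (sphMeasure 4).real Set.univ = 2 * Real.pi ^ 2 := by
  have : (sphMeasure 4).real Set.univ = (volume : Measure (E 4)).toSphere.real Set.univ := by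
    rw [measureReal_def, measureReal_def, sphMeasure, Measure.map_apply measurable_subtype_coe MeasurableSet.univ]
    simp
  rw [this, Measure.toSphere_real_apply_univ, vol_ball4]
  simp; ring

lemma exists_rot (y z : E 4) (h : ‖y‖ = ‖z‖) : ∃ U : E 4 ≃ₗᵢ[ℝ] E 4, U y = z :=
  ⟨(Submodule.span ℝ {y - z})ᗮ.reflection, Submodule.reflection_sub h⟩

lemma box_vol (l u : Fin 4 → ℝ) (h : ∀ i, l i ≤ u i) :
    volume {x : E 4 | ∀ i, l i < x i ∧ x i < u i} = ENNReal.ofReal (∏ i, (u i - l i)) := by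
  have h1 : {x : E 4 | ∀ i, l i < x i ∧ x i < u i}
      = WithLp.ofLp ⁻¹' (Set.univ.pi fun i => Set.Ioo (l i) (u i)) := by
    ext x; simp
  rw [h1, (PiLp.volume_preserving_ofLp (Fin 4)).measure_preimage
    (MeasurableSet.univ_pi fun i => measurableSet_Ioo).nullMeasurableSet, Real.volume_pi_Ioo,
    ENNReal.ofReal_prod_of_nonneg]
  intro i _; linarith [h i]

/-- The first basis vector. -/
def e0 : E 4 := EuclideanSpace.single 0 1

lemma e0_norm : ‖e0‖ = 1 := by simp [e0]

lemma nsq (x : E 4) : ‖x‖ ^ 2 = x 0 ^ 2 + x 1 ^ 2 + x 2 ^ 2 + x 3 ^ 2 := by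
  rw [EuclideanSpace.norm_sq_eq, Fin.sum_univ_four]; simp

lemma e0_dist (x : E 4) : ‖x - e0‖ ^ 2 = (x 0 - 1) ^ 2 + x 1 ^ 2 + x 2 ^ 2 + x 3 ^ 2 := by
  rw [nsq]; simp [e0]

lemma cap_meas (y : E 4) (r : ℝ) : MeasurableSet {x : E 4 | ‖x - y‖ < r} :=
  measurableSet_lt (by fun_prop) measurable_const

lemma cap_upper0 (r : ℝ) (hr : 0 ≤ r) :
    sphMeasure 4 {x | ‖x - e0‖ < r} ≤ ENNReal.ofReal (64 * r ^ 3) := by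
  rw [sph_apply (cap_meas _ _)]
  have hsub : coneOver {x | ‖x - e0‖ < r} ⊆
      {x : E 4 | ∀ i, (![-1, -r, -r, -r] : Fin 4 → ℝ) i < x i ∧ x i < (![1, r, r, r] : Fin 4 → ℝ) i} := by
    rintro x ⟨h0, h1, h2⟩
    have h3 : ‖‖x‖⁻¹ • x - e0‖ ^ 2 < r ^ 2 := by
      have : ‖‖x‖⁻¹ • x - e0‖ < r := h2
      gcongr
    have hx := nsq x
    rw [e0_dist] at h3
    simp only [PiLp.smul_apply, smul_eq_mul] at h3
    set ρ := ‖x‖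
    have key : ∀ t : ℝ, t = ρ * (ρ⁻¹ * t) := fun t => by field_simp
    have hb : ∀ t : ℝ, (ρ⁻¹ * t) ^ 2 < r ^ 2 → -r < t ∧ t < r := by
      intro t ht
      have h5 := abs_lt_of_sq_lt_sq' ht hr
      have h4 := key t
      set w := ρ⁻¹ * t
      constructor
      · rw [h4]; nlinarith
      · rw [h4]; nlinarith
    intro i
    fin_cases i
    · simp
      constructor <;> nlinarith [sq_nonneg (x 1), sq_nonneg (x 2), sq_nonneg (x 3)]
    · simpa using hb (x 1) (by nlinarith [sq_nonneg (ρ⁻¹ * x 0 - 1), sq_nonneg (ρ⁻¹ * x 2), sq_nonneg (ρ⁻¹ * x 3)])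
    · simpa using hb (x 2) (by nlinarith [sq_nonneg (ρ⁻¹ * x 0 - 1), sq_nonneg (ρ⁻¹ * x 1), sq_nonneg (ρ⁻¹ * x 3)])
    · simpa using hb (x 3) (by nlinarith [sq_nonneg (ρ⁻¹ * x 0 - 1), sq_nonneg (ρ⁻¹ * x 2), sq_nonneg (ρ⁻¹ * x 1)])
  have hm := measure_mono (μ := volume) hsub
  rw [box_vol _ _ (by intro i; fin_cases i <;> simp <;> linarith)] at hm
  refine (mul_le_mul_right hm 4).trans (le_of_eq ?_)
  rw [show (4 : ℝ≥0∞) = ENNReal.ofReal 4 by simp, ← ENNReal.ofReal_mul (by norm_num)]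
  congr 1
  simp [Fin.prod_univ_four]; ring

lemma cap_lower0 (r : ℝ) (hr : 0 < r) (hr1 : r ≤ 1) :
    ENNReal.ofReal (r ^ 3 / 64) ≤ sphMeasure 4 {x | ‖x - e0‖ < r} := by
  rw [sph_apply (cap_meas _ _)]
  have hsub : {x : E 4 | ∀ i, (![1/2, -(r/8), -(r/8), -(r/8)] : Fin 4 → ℝ) i < x i ∧ x i < (![3/4, r/8, r/8, r/8] : Fin 4 → ℝ) i} ⊆ coneOver {x | ‖x - e0‖ < r} := by
    intro x hx
    have hx0 := hx 0
    have hx1 := hx 1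
    have hx2 := hx 2
    have hx3 := hx 3
    simp at hx0 hx1 hx2 hx3
    have hn := nsq x
    have q1 : x 1 ^ 2 ≤ r ^ 2 / 64 := by nlinarith
    have q2 : x 2 ^ 2 ≤ r ^ 2 / 64 := by nlinarith
    have q3 : x 3 ^ 2 ≤ r ^ 2 / 64 := by nlinarith
    have hρ : 1 / 2 < ‖x‖ := by
      by_contra hc
      nlinarith [norm_nonneg x, sq_nonneg (x 1), sq_nonneg (x 2), sq_nonneg (x 3)]
    have hρ0 : x 0 ≤ ‖x‖ := by
      by_contra hc
      nlinarith [norm_nonneg x, sq_nonneg (x 1), sq_nonneg (x 2), sq_nonneg (x 3)]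
    refine ⟨by linarith, ?_, ?_⟩
    · by_contra hc
      nlinarith [norm_nonneg x]
    · show ‖‖x‖⁻¹ • x - e0‖ < r
      have h1 : ‖‖x‖⁻¹ • x - e0‖ ^ 2 = 2 * (‖x‖ - x 0) / ‖x‖ := by
        rw [e0_dist]
        simp only [PiLp.smul_apply, smul_eq_mul]
        field_simp
        linear_combination -hn
      have h2 : ‖x‖ - x 0 ≤ 3 * r ^ 2 / 64 := by nlinarith
      have h3 : ‖‖x‖⁻¹ • x - e0‖ ^ 2 < r ^ 2 := by
        rw [h1, div_lt_iff₀ (by linarith)]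
        nlinarith [sq_nonneg r, pow_pos hr 2]
      exact lt_of_pow_lt_pow_left₀ 2 hr.le h3
  have hm := measure_mono (μ := volume) hsub
  rw [box_vol _ _ (by intro i; fin_cases i <;> simp <;> linarith)] at hm
  refine (le_of_eq ?_).trans (mul_le_mul_right hm 4)
  rw [show (4 : ℝ≥0∞) = ENNReal.ofReal 4 by simp, ← ENNReal.ofReal_mul (by norm_num)]
  congr 1
  simp [Fin.prod_univ_four]; ring

lemma cap_rot (y : E 4) (hy : ‖y‖ = 1) (r : ℝ) :
    sphMeasure 4 {x | ‖x - y‖ < r} = sphMeasure 4 {x | ‖x - e0‖ < r} := by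
  obtain ⟨U, hU⟩ := exists_rot y e0 (by rw [hy, e0_norm])
  rw [← (sph_inv U).measure_preimage (cap_meas e0 r).nullMeasurableSet]
  congr 1
  ext x
  simp only [Set.mem_ofPred_eq, Set.mem_preimage, ← hU, ← map_sub, LinearIsometryEquiv.norm_map]

lemma cap_upper (y : E 4) (hy : ‖y‖ = 1) (r : ℝ) (hr : 0 ≤ r) :
    sphMeasure 4 {x | ‖x - y‖ < r} ≤ ENNReal.ofReal (64 * r ^ 3) := by
  rw [cap_rot y hy]; exact cap_upper0 r hr

lemma cap_lower (y : E 4) (hy : ‖y‖ = 1) (r : ℝ) (hr : 0 < r) (hr1 : r ≤ 1) :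
    ENNReal.ofReal (r ^ 3 / 64) ≤ sphMeasure 4 {x | ‖x - y‖ < r} := by
  rw [cap_rot y hy]; exact cap_lower0 r hr hr1

/-- Quaternion multiplication on `ℝ⁴`. -/
def qmul (a b : E 4) : E 4 := !₂[a 0 * b 0 - a 1 * b 1 - a 2 * b 2 - a 3 * b 3,
  a 0 * b 1 + a 1 * b 0 + a 2 * b 3 - a 3 * b 2,
  a 0 * b 2 - a 1 * b 3 + a 2 * b 0 + a 3 * b 1,
  a 0 * b 3 + a 1 * b 2 - a 2 * b 1 + a 3 * b 0]

lemma qmul_norm (a b : E 4) : ‖qmul a b‖ = ‖a‖ * ‖b‖ := by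
  have : ‖qmul a b‖ ^ 2 = (‖a‖ * ‖b‖) ^ 2 := by
    rw [mul_pow, nsq, nsq, nsq]
    simp [qmul]
    ring
  exact (pow_left_inj₀ (norm_nonneg _) (by positivity) two_ne_zero).1 this

lemma qmul_e0_sub (q y : E 4) : qmul q y - y = qmul (q - e0) y := by
  ext i
  fin_cases i <;> simp [qmul, e0] <;> ring

/-- Left multiplication by a unit quaternion. -/
def qL (q : E 4) (hq : ‖q‖ = 1) : E 4 ≃ₗᵢ[ℝ] E 4 :=
  LinearIsometry.toLinearIsometryEquiv
    { toFun := qmul q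
      map_add' := by intro x y; ext i; fin_cases i <;> simp [qmul] <;> ring
      map_smul' := by intro x y; ext i; fin_cases i <;> simp [qmul] <;> ring
      norm_map' := by intro x; show ‖qmul q x‖ = _; rw [qmul_norm, hq, one_mul] } rfl

/-- Right multiplication by a unit quaternion. -/
def qR (q : E 4) (hq : ‖q‖ = 1) : E 4 ≃ₗᵢ[ℝ] E 4 :=
  LinearIsometry.toLinearIsometryEquiv
    { toFun := fun x => qmul x q
      map_add' := by intro x y; ext i; fin_cases i <;> simp [qmul] <;> ring
      map_smul' := by intro x y; ext i; fin_cases i <;> simp [qmul] <;> ring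
      norm_map' := by intro x; show ‖qmul x q‖ = _; rw [qmul_norm, hq, mul_one] } rfl

lemma qL_apply (q : E 4) (hq : ‖q‖ = 1) (x : E 4) : qL q hq x = qmul q x := rfl
lemma qR_apply (q : E 4) (hq : ‖q‖ = 1) (x : E 4) : qR q hq x = qmul x q := rfl

open MvPolynomial in
lemma totalDegree_bind (f : Fin 4 → MvPolynomial (Fin 4) ℝ) (hf : ∀ i, (f i).totalDegree ≤ 1)
    (p : MvPolynomial (Fin 4) ℝ) : (bind₁ f p).totalDegree ≤ p.totalDegree := by
  conv_lhs => rw [p.as_sum]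
  rw [map_sum]
  refine totalDegree_finsetSum_le fun d hd => ?_
  rw [bind₁_monomial]
  refine (totalDegree_mul _ _).trans ?_
  rw [totalDegree_C, zero_add]
  refine (totalDegree_finsetProd _ _).trans ?_
  refine le_trans ?_ (le_totalDegree hd)
  rw [Finsupp.sum]
  refine Finset.sum_le_sum fun i _ => ?_
  refine (totalDegree_pow _ _).trans ?_
  nlinarith [hf i]

open MvPolynomial in
/-- The linear forms giving left multiplication by `q`. -/
def qform (q : E 4) : Fin 4 → MvPolynomial (Fin 4) ℝ :=
  ![C (q 0) * X 0 + C (- q 1) * X 1 + C (-q 2) * X 2 + C (- q 3) * X 3,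
    C (q 0) * X 1 + C (q 1) * X 0 + C (q 2) * X 3 + C (-q 3) * X 2,
    C (q 0) * X 2 + C (-q 1) * X 3 + C (q 2) * X 0 + C (q 3) * X 1,
    C (q 0) * X 3 + C (q 1) * X 2 + C (-q 2) * X 1 + C (q 3) * X 0]

open MvPolynomial in
lemma lin_deg (a b c d : ℝ) (i j k l : Fin 4) :
    (C a * X i + C b * X j + C c * X k + C d * X l : MvPolynomial (Fin 4) ℝ).totalDegree ≤ 1 := by
  have h : ∀ (a : ℝ) (i : Fin 4), (C a * X i : MvPolynomial (Fin 4) ℝ).totalDegree ≤ 1 := by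
    intro a i
    refine (totalDegree_mul _ _).trans ?_
    rw [totalDegree_C, totalDegree_X]
  refine (totalDegree_add _ _).trans (max_le ((totalDegree_add _ _).trans (max_le
    ((totalDegree_add _ _).trans (max_le (h _ _) (h _ _))) (h _ _))) (h _ _))

lemma qform_deg (q : E 4) (i : Fin 4) : (qform q i).totalDegree ≤ 1 := by
  fin_cases i <;> exact lin_deg _ _ _ _ _ _ _ _

lemma qform_eval (q x : E 4) (i : Fin 4) :
    MvPolynomial.eval (fun j => x j) (qform q i) = qmul q x i := by
  fin_cases i <;> simp [qform, qmul] <;> ring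

lemma bind_eval (q x : E 4) (p : MvPolynomial (Fin 4) ℝ) :
    MvPolynomial.eval (fun j => x j) (MvPolynomial.bind₁ (qform q) p)
      = MvPolynomial.eval (fun j => qmul q x j) p := by
  simp only [MvPolynomial.eval, MvPolynomial.eval₂Hom_bind₁]
  congr 1
  congr 1
  ext i
  exact qform_eval q x i

lemma bind_mem (m : ℕ) (q : E 4) (hq : ‖q‖ = 1) (p : MvPolynomial (Fin 4) ℝ) (hp : p ∈ P0 4 m) :
    MvPolynomial.bind₁ (qform q) p ∈ P0 4 m := by
  refine ⟨(totalDegree_bind _ (qform_deg q) p).trans hp.1, ?_⟩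
  simp_rw [bind_eval]
  have := sph_inv_integral (qL q hq) (fun x => MvPolynomial.eval (fun i => x i) p)
  simp only [qL_apply] at this
  rw [this]
  exact hp.2

lemma eval_cont (p : MvPolynomial (Fin 4) ℝ) :
    Continuous fun x : E 4 => MvPolynomial.eval (fun i => x i) p := by
  have h1 := MvPolynomial.continuous_eval p
  exact h1.comp (by fun_prop : Continuous fun x : E 4 => (fun i => x i : Fin 4 → ℝ))

lemma sph_integrable {F : E 4 → ℝ} (hF : Continuous F) : Integrable F (sphMeasure 4) := by
  obtain ⟨C, hC⟩ := (isCompact_sphere (0 : E 4) 1).exists_bound_of_continuousOn hF.continuousOn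
  refine Integrable.of_bound hF.aestronglyMeasurable C ?_
  filter_upwards [sph_ae] with x hx
  exact hC x (by simpa using hx)

lemma constr (m : ℕ) (T : Finset (E 4)) (W : E 4 → ℝ) (hT : ∀ y ∈ T, ‖y‖ = 1)
    (hquad : ∀ p ∈ P0 4 m, ∑ y ∈ T, W y * MvPolynomial.eval (fun j => y j) p = 0)
    (g : ℝ → ℝ) (hg : Continuous fun x : E 4 => g (‖x‖ ^ 2))
    (p : MvPolynomial (Fin 4) ℝ) (hp : p ∈ P0 4 m) :
    ∫ x, MvPolynomial.eval (fun i => x i) p * ∑ y ∈ T, W y * g (‖x - y‖ ^ 2) ∂(sphMeasure 4) = 0 := by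
  have hgc : ∀ y : E 4, Continuous fun x : E 4 => g (‖x - y‖ ^ 2) := fun y =>
    hg.comp (by fun_prop : Continuous fun x : E 4 => x - y)
  have hq : ∀ y : E 4, Continuous fun x : E 4 => MvPolynomial.eval (fun i => qmul x y i) p := by
    intro y
    refine (eval_cont p).comp (?_ : Continuous fun x : E 4 => qmul x y)
    unfold qmul
    fun_prop
  have h1 : ∀ y ∈ T, ∫ x, MvPolynomial.eval (fun i => x i) p * (W y * g (‖x - y‖ ^ 2)) ∂(sphMeasure 4)
      = ∫ x, g (‖x - e0‖ ^ 2) * (W y * MvPolynomial.eval (fun i => qmul x y i) p) ∂(sphMeasure 4) := by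
    intro y hy
    rw [← sph_inv_integral (qR y (hT y hy))]
    congr 1
    ext x
    rw [qR_apply, qmul_e0_sub, qmul_norm, hT y hy, mul_one]
    ring
  simp_rw [Finset.mul_sum]
  rw [integral_finsetSum]
  · rw [Finset.sum_congr rfl h1, ← integral_finsetSum]
    · apply integral_eq_zero_of_ae
      filter_upwards [sph_ae] with q hq
      rw [← Finset.mul_sum]
      have := hquad _ (bind_mem m q hq p hp)
      simp_rw [bind_eval] at this
      rw [this]; simp
    · intro y _
      exact sph_integrable ((hgc e0).mul (continuous_const.mul (hq y)))
  · intro y _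
    exact sph_integrable ((eval_cont p).mul (continuous_const.mul (hgc y)))

lemma sph_inv_sq_bound (y : E 4) (hy : ‖y‖ = 1) (ε : ℝ) (hε : 0 < ε) :
    ∫ x, 1 / (ε ^ 2 + ‖x - y‖ ^ 2) ∂(sphMeasure 4) ≤ 2 * Real.pi ^ 2 + 128 := by
  have hpos : ∀ x : E 4, 0 < ε ^ 2 + ‖x - y‖ ^ 2 := fun x => by positivity
  have hc : Continuous fun x : E 4 => 1 / (ε ^ 2 + ‖x - y‖ ^ 2) :=
    continuous_const.div (by fun_prop) fun x => (hpos x).ne'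
  have h_integ := sph_integrable hc
  rw [h_integ.integral_eq_integral_meas_lt (Eventually.of_forall fun x => by
    have := hpos x; simp only [Pi.zero_apply]; positivity)]
  have hI1 : IntegrableOn (fun _ : ℝ => 2 * Real.pi ^ 2) (Set.Ioc 0 1) :=
    integrableOn_const (by simp)
  have hI2 : IntegrableOn (fun t : ℝ => 64 * t ^ (-(3/2) : ℝ)) (Set.Ioi 1) :=
    (integrableOn_Ioi_rpow_of_lt (by norm_num) one_pos).const_mul 64
  rw [← Set.Ioc_union_Ioi_eq_Ioi (zero_le_one (α := ℝ))]
  have hanti : AntitoneOn (fun t : ℝ => (sphMeasure 4).real {a | t < 1 / (ε ^ 2 + ‖a - y‖ ^ 2)}) Set.univ := by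
    intro s _ t _ hst
    exact measureReal_mono (fun a (ha : t < _) => lt_of_le_of_lt hst ha)
  have hmeas : Measurable (fun t : ℝ => (sphMeasure 4).real {a | t < 1 / (ε ^ 2 + ‖a - y‖ ^ 2)}) :=
    Antitone.measurable (fun s t hst => hanti (Set.mem_univ _) (Set.mem_univ _) hst)
  have hb1 : ∀ t : ℝ, (sphMeasure 4).real {a | t < 1 / (ε ^ 2 + ‖a - y‖ ^ 2)} ≤ 2 * Real.pi ^ 2 := by
    intro t
    rw [← sph_univ]
    exact measureReal_mono (Set.subset_univ _)
  have hb2 : ∀ t ∈ Set.Ioi (1:ℝ), (sphMeasure 4).real {a | t < 1 / (ε ^ 2 + ‖a - y‖ ^ 2)} ≤ 64 * t ^ (-(3/2) : ℝ) := by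
    intro t ht
    have ht0 : (0:ℝ) < t := lt_trans one_pos ht
    have h1 := cap_upper y hy (t ^ (-(1/2) : ℝ)) (by positivity)
    have h2 : {a | t < 1 / (ε ^ 2 + ‖a - y‖ ^ 2)} ⊆ {x | ‖x - y‖ < t ^ (-(1/2) : ℝ)} := by
      intro a ha
      have ha : t < 1 / (ε ^ 2 + ‖a - y‖ ^ 2) := ha
      show ‖a - y‖ < _
      refine lt_of_pow_lt_pow_left₀ 2 (by positivity) ?_
      have : (t ^ (-(1/2) : ℝ)) ^ 2 = t⁻¹ := by
        rw [← Real.rpow_natCast, ← Real.rpow_mul ht0.le, ← Real.rpow_neg_one]; norm_num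
      rw [this, inv_eq_one_div, lt_div_iff₀ ht0]
      rw [lt_div_iff₀ (hpos a)] at ha
      nlinarith [sq_nonneg ε]
    have h3 : (t ^ (-(1/2) : ℝ)) ^ 3 = t ^ (-(3/2) : ℝ) := by
      rw [← Real.rpow_natCast, ← Real.rpow_mul ht0.le]; norm_num
    rw [h3] at h1
    exact ENNReal.toReal_le_of_le_ofReal (by positivity) ((measure_mono h2).trans h1)
  have hf1 : IntegrableOn (fun t : ℝ => (sphMeasure 4).real {a | t < 1 / (ε ^ 2 + ‖a - y‖ ^ 2)}) (Set.Ioc 0 1) :=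
    Integrable.mono' hI1 hmeas.aestronglyMeasurable (Eventually.of_forall fun t => by
      rw [Real.norm_of_nonneg measureReal_nonneg]; exact hb1 t)
  have hf2 : IntegrableOn (fun t : ℝ => (sphMeasure 4).real {a | t < 1 / (ε ^ 2 + ‖a - y‖ ^ 2)}) (Set.Ioi 1) :=
    Integrable.mono' hI2 hmeas.aestronglyMeasurable (by
      filter_upwards [ae_restrict_mem measurableSet_Ioi] with t ht
      rw [Real.norm_of_nonneg measureReal_nonneg]; exact hb2 t ht)
  rw [setIntegral_union (Set.Ioc_disjoint_Ioi le_rfl) measurableSet_Ioi hf1 hf2]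
  refine add_le_add ?_ ?_
  · refine (setIntegral_mono_on hf1 hI1 measurableSet_Ioc fun t _ => hb1 t).trans ?_
    simp
  · refine (setIntegral_mono_on hf2 hI2 measurableSet_Ioi hb2).trans ?_
    rw [integral_const_mul, integral_Ioi_rpow_of_lt (by norm_num) one_pos]
    norm_num

lemma half_ball_integral (y : E 4) (hy : ‖y‖ = 1) (g : ℝ → ℝ) (hg : Continuous g) (h0 : ∀ r, 0 ≤ g r) :
    ∫ x in ball (0 : E 4) 1, g ‖x - y‖ ≤ Real.pi ^ 2 * ∫ r in (0:ℝ)..2, r ^ 3 * g r := by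
  have hcont : Continuous fun z : E 4 => g ‖z‖ := hg.comp continuous_norm
  have h_integ : ∀ (c : E 4) (r : ℝ), IntegrableOn (fun z : E 4 => g ‖z‖) (ball c r) := fun c r =>
    (hcont.continuousOn.integrableOn_compact (isCompact_closedBall c r)).mono_set ball_subset_closedBall
  have h1 : ∫ x in ball (0 : E 4) 1, g ‖x - y‖ = ∫ z in ball (-y) 1, g ‖z‖ := by
    have := (measurePreserving_sub_right (volume : Measure (E 4)) y).setIntegral_preimage_emb
      (measurableEmbedding_subRight y) (fun z => g ‖z‖) (ball (-y) 1)
    rw [← this]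
    congr 2
    ext x
    simp [dist_eq_norm]
  have h2 : ∫ z in ball (-y) 1, g ‖z‖ = ∫ z in ball y 1, g ‖z‖ := by
    have := (Measure.measurePreserving_neg (volume : Measure (E 4))).setIntegral_preimage_emb
      (MeasurableEquiv.neg (E 4)).measurableEmbedding (fun z => g ‖z‖) (ball y 1)
    rw [← this]
    simp only [norm_neg]
    congr 2
    ext x
    simp only [mem_ball, dist_eq_norm, Set.mem_preimage]
    rw [← norm_neg]; congr! 2; abel
  have hdisj : Disjoint (ball (-y) 1) (ball y 1) := by
    apply ball_disjoint_ball
    rw [dist_eq_norm, show -y - y = (-2 : ℝ) • y by module, norm_smul, hy]; norm_num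
  have h3 : ∫ z in ball (-y) 1, g ‖z‖ + g ‖z‖ = ∫ z in ball (-y) 1 ∪ ball y 1, g ‖z‖ := by
    rw [setIntegral_union hdisj measurableSet_ball (h_integ _ _) (h_integ _ _), ← h2,
      integral_add (h_integ _ _) (h_integ _ _)]
  have h4 : ∫ z in ball (-y) 1 ∪ ball y 1, g ‖z‖ ≤ ∫ z in ball (0 : E 4) 2, g ‖z‖ := by
    refine setIntegral_mono_set (h_integ _ _) (Eventually.of_forall fun z => h0 _) ?_
    refine (Set.union_subset ?_ ?_).eventuallyLE
    · refine ball_subset_ball' ?_; simp [hy]; norm_num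
    · refine ball_subset_ball' ?_; simp [hy]; norm_num
  have h5 : ∫ z in ball (0 : E 4) 2, g ‖z‖ = 2 * Real.pi ^ 2 * ∫ r in (0:ℝ)..2, r ^ 3 * g r := by
    rw [← integral_indicator measurableSet_ball]
    have : ∀ z : E 4, (ball (0 : E 4) 2).indicator (fun z => g ‖z‖) z = (Set.Iio (2:ℝ)).indicator g ‖z‖ := by
      intro z
      simp [Set.indicator]
    simp_rw [this]
    rw [integral_fun_norm_addHaar, vol_ball4]
    have h6 : ∫ r in Set.Ioi (0:ℝ), r ^ (Module.finrank ℝ (E 4) - 1) • (Set.Iio (2:ℝ)).indicator g r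
        = ∫ r in (0:ℝ)..2, r ^ 3 * g r := by
      rw [intervalIntegral.integral_of_le (by norm_num), integral_Ioc_eq_integral_Ioo,
        ← Set.Ioi_inter_Iio, ← setIntegral_indicator measurableSet_Iio]
      congr 1
      ext r
      simp [Set.indicator]
    rw [h6]
    simp; ring
  have h7 : ∫ z in ball (-y) 1, g ‖z‖ + g ‖z‖ = 2 * ∫ z in ball (-y) 1, g ‖z‖ := by
    rw [integral_add (h_integ _ _) (h_integ _ _)]; ring
  rw [h1]
  linarith

lemma radial_bound (ε K1 K2 : ℝ) (hε : 0 < ε) (hε1 : ε ≤ 1) (hK1 : 0 ≤ K1) (hK2 : 0 ≤ K2) :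
    ∫ r in (0:ℝ)..2, r ^ 3 * (K1 / (ε ^ 2 + r ^ 2) ^ 2 + K2 * ε ^ 2 / (ε ^ 2 + r ^ 2) ^ 3)
      ≤ K1 * Real.log (1 / ε) + 2 * K1 + K2 := by
  have hp : ∀ r : ℝ, 0 < ε ^ 2 + r ^ 2 := fun r => by positivity
  have hne : ∀ r : ℝ, ε ^ 2 + r ^ 2 ≠ 0 := fun r => (hp r).ne'
  have hc1 : Continuous fun r : ℝ => r ^ 3 * (K1 / (ε ^ 2 + r ^ 2) ^ 2 + K2 * ε ^ 2 / (ε ^ 2 + r ^ 2) ^ 3) := by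
    fun_prop (disch := intro r; exact pow_ne_zero _ (hne r))
  have hc2 : Continuous fun r : ℝ => K1 * r / (ε ^ 2 + r ^ 2) + K2 * ε ^ 2 * r / (ε ^ 2 + r ^ 2) ^ 2 := by
    refine Continuous.add (Continuous.div (by fun_prop) (by fun_prop) hne)
      (Continuous.div (by fun_prop) (by fun_prop) fun r => pow_ne_zero _ (hne r))
  have hd : ∀ r : ℝ, HasDerivAt (fun r : ℝ => K1 / 2 * Real.log (ε ^ 2 + r ^ 2) - K2 * ε ^ 2 / 2 * (ε ^ 2 + r ^ 2)⁻¹)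
      (K1 * r / (ε ^ 2 + r ^ 2) + K2 * ε ^ 2 * r / (ε ^ 2 + r ^ 2) ^ 2) r := by
    intro r
    have hb : HasDerivAt (fun r : ℝ => ε ^ 2 + r ^ 2) (2 * r) r := by
      simpa using (hasDerivAt_pow 2 r).const_add (ε ^ 2)
    refine HasDerivAt.congr_deriv (((hb.log (hne r)).const_mul (K1 / 2)).sub ((hb.inv (hne r)).const_mul (K2 * ε ^ 2 / 2))) ?_
    have := hne r
    field_simp
    ring
  calc _ ≤ ∫ r in (0:ℝ)..2, (K1 * r / (ε ^ 2 + r ^ 2) + K2 * ε ^ 2 * r / (ε ^ 2 + r ^ 2) ^ 2) := by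
        refine intervalIntegral.integral_mono_on (by norm_num) (hc1.intervalIntegrable _ _) (hc2.intervalIntegrable _ _) ?_
        intro r hr
        have h := hp r
        have e : K1 * r / (ε ^ 2 + r ^ 2) + K2 * ε ^ 2 * r / (ε ^ 2 + r ^ 2) ^ 2
          - r ^ 3 * (K1 / (ε ^ 2 + r ^ 2) ^ 2 + K2 * ε ^ 2 / (ε ^ 2 + r ^ 2) ^ 3)
          = K1 * r * ε ^ 2 / (ε ^ 2 + r ^ 2) ^ 2 + K2 * ε ^ 2 * r * ε ^ 2 / (ε ^ 2 + r ^ 2) ^ 3 := by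
          field_simp; ring
        have : 0 ≤ K1 * r * ε ^ 2 / (ε ^ 2 + r ^ 2) ^ 2 + K2 * ε ^ 2 * r * ε ^ 2 / (ε ^ 2 + r ^ 2) ^ 3 := by
          have := hr.1
          positivity
        linarith
    _ = _ := intervalIntegral.integral_eq_sub_of_hasDerivAt (fun r _ => hd r) (hc2.intervalIntegrable _ _)
    _ ≤ _ := by
      have hl : Real.log (ε ^ 2 + 2 ^ 2) ≤ 4 := by
        have := Real.log_le_sub_one_of_pos (hp 2)
        nlinarith
      have hl2 : Real.log (ε ^ 2 + 0 ^ 2) = 2 * Real.log ε := by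
        rw [zero_pow two_ne_zero, add_zero, Real.log_pow]; norm_num
      rw [hl2]
      have h3 : K2 * ε ^ 2 / 2 * (ε ^ 2 + 0 ^ 2)⁻¹ = K2 / 2 := by
        field_simp; ring
      rw [h3, one_div, Real.log_inv]
      have : 0 ≤ K2 * ε ^ 2 / 2 * (ε ^ 2 + 2 ^ 2)⁻¹ := by positivity
      have := mul_le_mul_of_nonneg_left hl (by linarith : 0 ≤ K1 / 2)
      linarith

lemma ball_bound (y : E 4) (hy : ‖y‖ = 1) (ε K1 K2 : ℝ) (hε : 0 < ε) (hε1 : ε ≤ 1) (hK1 : 0 ≤ K1) (hK2 : 0 ≤ K2) :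
    ∫ x in ball (0 : E 4) 1, (K1 / (ε ^ 2 + ‖x - y‖ ^ 2) ^ 2 + K2 * ε ^ 2 / (ε ^ 2 + ‖x - y‖ ^ 2) ^ 3)
      ≤ Real.pi ^ 2 * (K1 * Real.log (1 / ε) + 2 * K1 + K2) := by
  have hne : ∀ r : ℝ, ε ^ 2 + r ^ 2 ≠ 0 := fun r => by positivity
  refine (half_ball_integral y hy (fun r => K1 / (ε ^ 2 + r ^ 2) ^ 2 + K2 * ε ^ 2 / (ε ^ 2 + r ^ 2) ^ 3)
    ?_ ?_).trans ?_
  · exact Continuous.add (Continuous.div (by fun_prop) (by fun_prop) fun r => pow_ne_zero _ (hne r))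
      (Continuous.div (by fun_prop) (by fun_prop) fun r => pow_ne_zero _ (hne r))
  · intro r; positivity
  · gcongr
    exact radial_bound ε K1 K2 hε hε1 hK1 hK2

/-- The modified squared distance to `y`: equal to `‖x-y‖²` on the sphere, zero radial derivative. -/
def sfun (y x : E 4) : ℝ := ‖x - y‖ ^ 2 * Real.exp ((1 - ‖x‖ ^ 2) / 2)

/-- First derivative of `sfun`. -/
def ds (y x v : E 4) : ℝ :=
  Real.exp ((1 - ‖x‖ ^ 2) / 2) * (2 * ⟪x - y, v⟫ - ‖x - y‖ ^ 2 * ⟪x, v⟫)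

/-- Second derivative of `sfun`. -/
def dds (y x v : E 4) : ℝ :=
  Real.exp ((1 - ‖x‖ ^ 2) / 2) * (2 * ⟪v, v⟫ - 2 * ⟪x - y, v⟫ * ⟪x, v⟫ - ‖x - y‖ ^ 2 * ⟪v, v⟫
    - ⟪x, v⟫ * (2 * ⟪x - y, v⟫ - ‖x - y‖ ^ 2 * ⟪x, v⟫))

lemma line_hasDeriv (x v : E 4) (s : ℝ) : HasDerivAt (fun s : ℝ => x + s • v) v s := by
  simpa using ((hasDerivAt_id s).smul_const v).const_add x

lemma exp_line (x v : E 4) (s : ℝ) : HasDerivAt (fun s : ℝ => Real.exp ((1 - ‖x + s • v‖ ^ 2) / 2))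
    (- ⟪x + s • v, v⟫ * Real.exp ((1 - ‖x + s • v‖ ^ 2) / 2)) s := by
  have h1 := (((line_hasDeriv x v s).norm_sq.const_sub 1).div_const 2).exp
  refine h1.congr_deriv ?_
  ring

lemma sfun_line (y x v : E 4) (s : ℝ) :
    HasDerivAt (fun s : ℝ => sfun y (x + s • v)) (ds y (x + s • v) v) s := by
  have h2 : HasDerivAt (fun s : ℝ => x + s • v - y) v s := (line_hasDeriv x v s).sub_const y
  refine (h2.norm_sq.mul (exp_line x v s)).congr_deriv ?_
  unfold ds
  ring

lemma ds_line (y x v : E 4) (s : ℝ) :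
    HasDerivAt (fun s : ℝ => ds y (x + s • v) v) (dds y (x + s • v) v) s := by
  have h2 : HasDerivAt (fun s : ℝ => x + s • v - y) v s := (line_hasDeriv x v s).sub_const y
  have h3 : HasDerivAt (fun s : ℝ => ⟪x + s • v - y, v⟫) ⟪v, v⟫ s := by
    simpa using h2.inner ℝ (hasDerivAt_const s v)
  have h4 : HasDerivAt (fun s : ℝ => ⟪x + s • v, v⟫) ⟪v, v⟫ s := by
    simpa using (line_hasDeriv x v s).inner ℝ (hasDerivAt_const s v)
  refine ((exp_line x v s).mul ((h3.const_mul 2).sub (h2.norm_sq.mul h4))).congr_deriv ?_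
  unfold dds
  simp only [Pi.sub_apply, Pi.mul_apply]
  ring

lemma fderiv_of_line {g : E 4 → ℝ} {x v : E 4} {d : ℝ} (hg : DifferentiableAt ℝ g x)
    (h : HasDerivAt (fun s : ℝ => g (x + s • v)) d 0) : fderiv ℝ g x v = d := by
  rw [← hg.lineDeriv_eq_fderiv]
  exact HasLineDerivAt.lineDeriv h

lemma sfun_smooth (y : E 4) : ContDiff ℝ (⊤ : ℕ∞) (sfun y) := by
  unfold sfun
  have h1 : ContDiff ℝ (⊤ : ℕ∞) fun x : E 4 => ‖x - y‖ ^ 2 := (contDiff_id.sub contDiff_const).norm_sq ℝ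
  have h2 : ContDiff ℝ (⊤ : ℕ∞) fun x : E 4 => ‖x‖ ^ 2 := contDiff_id.norm_sq ℝ
  exact h1.mul ((contDiff_const.sub h2).div_const 2).exp

lemma sfun_nonneg (y x : E 4) : 0 ≤ sfun y x := by unfold sfun; positivity

lemma ds_smooth (y v : E 4) : ContDiff ℝ (⊤ : ℕ∞) (fun x => ds y x v) := by
  unfold ds
  have h1 : ContDiff ℝ (⊤ : ℕ∞) fun x : E 4 => ‖x - y‖ ^ 2 := (contDiff_id.sub contDiff_const).norm_sq ℝ
  have h2 : ContDiff ℝ (⊤ : ℕ∞) fun x : E 4 => ‖x‖ ^ 2 := contDiff_id.norm_sq ℝ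
  have h3 : ContDiff ℝ (⊤ : ℕ∞) fun x : E 4 => ⟪x - y, v⟫ := (contDiff_id.sub contDiff_const).inner ℝ contDiff_const
  have h4 : ContDiff ℝ (⊤ : ℕ∞) fun x : E 4 => ⟪x, v⟫ := contDiff_id.inner ℝ contDiff_const
  exact ((contDiff_const.sub h2).div_const 2).exp.mul ((contDiff_const.mul h3).sub (h1.mul h4))

/-- `ε² + s`. -/
def Af (ε : ℝ) (y x : E 4) : ℝ := ε ^ 2 + sfun y x

/-- The sum of bubbles to the power three. -/
def Phi (ε : ℝ) (T : Finset (E 4)) (W : E 4 → ℝ) (x : E 4) : ℝ := ∑ y ∈ T, W y * (Af ε y x ^ 3)⁻¹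

/-- The test function. -/
def uf (ε : ℝ) (T : Finset (E 4)) (W : E 4 → ℝ) (x : E 4) : ℝ := 1 / 3 * Real.log (Phi ε T W x)

lemma Af_pos {ε : ℝ} (hε : 0 < ε) (y x : E 4) : 0 < Af ε y x := by
  have := sfun_nonneg y x
  unfold Af; positivity

lemma Phi_pos {ε : ℝ} (hε : 0 < ε) {T : Finset (E 4)} {W : E 4 → ℝ} (hT : T.Nonempty)
    (hW : ∀ y ∈ T, 0 < W y) (x : E 4) : 0 < Phi ε T W x := by
  refine Finset.sum_pos (fun y hy => ?_) hT
  have := Af_pos hε y x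
  have := hW y hy
  positivity

lemma Af_smooth (ε : ℝ) (y : E 4) : ContDiff ℝ (⊤ : ℕ∞) (Af ε y) :=
  contDiff_const.add (sfun_smooth y)

lemma Phi_smooth {ε : ℝ} (hε : 0 < ε) (T : Finset (E 4)) (W : E 4 → ℝ) :
    ContDiff ℝ (⊤ : ℕ∞) (Phi ε T W) := by
  unfold Phi
  refine ContDiff.sum fun y _ => contDiff_const.mul (ContDiff.inv ((Af_smooth ε y).pow 3) ?_)
  intro x; exact pow_ne_zero _ (Af_pos hε y x).ne'

lemma uf_smooth {ε : ℝ} (hε : 0 < ε) {T : Finset (E 4)} {W : E 4 → ℝ} (hT : T.Nonempty)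
    (hW : ∀ y ∈ T, 0 < W y) : ContDiff ℝ (⊤ : ℕ∞) (uf ε T W) := by
  unfold uf
  exact contDiff_const.mul (ContDiff.log (Phi_smooth hε T W) fun x => (Phi_pos hε hT hW x).ne')

lemma Af_line (ε : ℝ) (y x v : E 4) (s : ℝ) :
    HasDerivAt (fun s : ℝ => Af ε y (x + s • v)) (ds y (x + s • v) v) s :=
  (sfun_line y x v s).const_add _

/-- First derivative of `Phi` up to a factor. -/
def Psi (ε : ℝ) (T : Finset (E 4)) (W : E 4 → ℝ) (x v : E 4) : ℝ :=
  ∑ y ∈ T, W y * (Af ε y x ^ 4)⁻¹ * ds y x v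

lemma Phi_line {ε : ℝ} (hε : 0 < ε) (T : Finset (E 4)) (W : E 4 → ℝ) (x v : E 4) (s : ℝ) :
    HasDerivAt (fun s : ℝ => Phi ε T W (x + s • v)) (-3 * Psi ε T W (x + s • v) v) s := by
  unfold Phi Psi
  rw [Finset.mul_sum]
  refine HasDerivAt.fun_sum fun y _ => ?_
  have hA := (Af_pos hε y (x + s • v)).ne'
  refine ((((Af_line ε y x v s).pow 3).inv (pow_ne_zero 3 hA)).const_mul (W y)).congr_deriv ?_
  simp only [Pi.pow_apply]
  field_simp
  norm_num
  ring

lemma Psi_line {ε : ℝ} (hε : 0 < ε) (T : Finset (E 4)) (W : E 4 → ℝ) (x v : E 4) (s : ℝ) :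
    HasDerivAt (fun s : ℝ => Psi ε T W (x + s • v) v)
      (∑ y ∈ T, (W y * (Af ε y (x + s • v) ^ 4)⁻¹ * dds y (x + s • v) v
        - 4 * (W y * (Af ε y (x + s • v) ^ 5)⁻¹ * ds y (x + s • v) v ^ 2))) s := by
  unfold Psi
  refine HasDerivAt.fun_sum fun y _ => ?_
  have hA := (Af_pos hε y (x + s • v)).ne'
  refine (((((Af_line ε y x v s).pow 4).inv (pow_ne_zero 4 hA)).const_mul (W y)).mul
    (ds_line y x v s)).congr_deriv ?_
  simp only [Pi.pow_apply, Pi.inv_apply]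
  field_simp
  ring

lemma Psi_smooth {ε : ℝ} (hε : 0 < ε) (T : Finset (E 4)) (W : E 4 → ℝ) (v : E 4) :
    ContDiff ℝ (⊤ : ℕ∞) (fun x => Psi ε T W x v) := by
  unfold Psi
  refine ContDiff.sum fun y _ => (contDiff_const.mul (ContDiff.inv ((Af_smooth ε y).pow 4) ?_)).mul
    (ds_smooth y v)
  intro x; exact pow_ne_zero _ (Af_pos hε y x).ne'

lemma uf_fderiv {ε : ℝ} (hε : 0 < ε) {T : Finset (E 4)} {W : E 4 → ℝ} (hT : T.Nonempty)
    (hW : ∀ y ∈ T, 0 < W y) (x v : E 4) :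
    fderiv ℝ (uf ε T W) x v = - (Psi ε T W x v / Phi ε T W x) := by
  refine fderiv_of_line ((uf_smooth hε hT hW).differentiable (by simp) x) ?_
  have := ((Phi_line hε T W x v 0).log (by simpa using (Phi_pos hε hT hW x).ne')).const_mul (1/3)
  refine this.congr_deriv ?_
  simp
  ring

lemma uf_fderiv2 {ε : ℝ} (hε : 0 < ε) {T : Finset (E 4)} {W : E 4 → ℝ} (hT : T.Nonempty)
    (hW : ∀ y ∈ T, 0 < W y) (x v : E 4) :
    fderiv ℝ (fun z => fderiv ℝ (uf ε T W) z v) x v =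
      - ((∑ y ∈ T, (W y * (Af ε y x ^ 4)⁻¹ * dds y x v
        - 4 * (W y * (Af ε y x ^ 5)⁻¹ * ds y x v ^ 2))) / Phi ε T W x
        + 3 * (Psi ε T W x v / Phi ε T W x) ^ 2) := by
  simp_rw [uf_fderiv hε hT hW]
  have hP := (Phi_pos hε hT hW x).ne'
  refine fderiv_of_line ?_ ?_
  · exact ((Psi_smooth hε T W v).div (Phi_smooth hε T W)
      fun z => (Phi_pos hε hT hW z).ne').neg.differentiable (by simp) x
  · have := ((Psi_line hε T W x v 0).div (Phi_line hε T W x v 0) (by simpa using hP)).neg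
    refine this.congr_deriv ?_
    simp only [zero_smul, add_zero]
    field_simp
    ring

lemma sfun_sphere (y x : E 4) (hx : ‖x‖ = 1) : sfun y x = ‖x - y‖ ^ 2 := by
  simp [sfun, hx]

lemma ds_sphere (y x : E 4) (hx : ‖x‖ = 1) (hy : ‖y‖ = 1) : ds y x x = 0 := by
  have h1 : ‖x - y‖ ^ 2 = ‖x‖ ^ 2 - 2 * ⟪x, y⟫ + ‖y‖ ^ 2 := norm_sub_sq_real x y
  have h2 : ⟪x - y, x⟫ = ‖x‖ ^ 2 - ⟪x, y⟫ := by
    rw [inner_sub_left, real_inner_self_eq_norm_sq, real_inner_comm]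
  simp only [ds, h1, h2, real_inner_self_eq_norm_sq, hx, hy]
  ring

lemma uf_radial {ε : ℝ} (hε : 0 < ε) {T : Finset (E 4)} {W : E 4 → ℝ} (hT : T.Nonempty)
    (hW : ∀ y ∈ T, 0 < W y) (hT1 : ∀ y ∈ T, ‖y‖ = 1) (x : E 4) (hx : ‖x‖ = 1) :
    fderiv ℝ (uf ε T W) x x = 0 := by
  rw [uf_fderiv hε hT hW]
  have : Psi ε T W x x = 0 := by
    refine Finset.sum_eq_zero fun y hy => ?_
    rw [ds_sphere y x hx (hT1 y hy), mul_zero]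
  simp [this]

lemma exp_uf {ε : ℝ} (hε : 0 < ε) {T : Finset (E 4)} {W : E 4 → ℝ} (hT : T.Nonempty)
    (hW : ∀ y ∈ T, 0 < W y) (x : E 4) : Real.exp (3 * uf ε T W x) = Phi ε T W x := by
  rw [uf, ← mul_assoc]; norm_num
  exact Real.exp_log (Phi_pos hε hT hW x)

/-- Coordinate vector. -/
abbrev ev (i : Fin 4) : E 4 := EuclideanSpace.single i 1

lemma inner_ev (a : E 4) (i : Fin 4) : ⟪a, ev i⟫ = a i := by
  rw [ev, EuclideanSpace.inner_single_right]; simp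

lemma inner_coord (a b : E 4) : ⟪a, b⟫ = a 0 * b 0 + a 1 * b 1 + a 2 * b 2 + a 3 * b 3 := by
  simp [PiLp.inner_apply, Fin.sum_univ_four]; ring

lemma sum_ds_sq (y x : E 4) : ∑ i, ds y x (ev i) ^ 2 =
    Real.exp ((1 - ‖x‖ ^ 2) / 2) ^ 2 * ‖x - y‖ ^ 2 * (4 - 4 * ⟪x - y, x⟫ + ‖x - y‖ ^ 2 * ‖x‖ ^ 2) := by
  have h1 := nsq (x - y)
  have h2 := nsq x
  simp only [ds, inner_ev, Fin.sum_univ_four]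
  rw [inner_coord]
  set R := ‖x - y‖ ^ 2
  rw [h2]
  set τ := Real.exp ((1 - (x 0 ^ 2 + x 1 ^ 2 + x 2 ^ 2 + x 3 ^ 2)) / 2)
  linear_combination (-4 * τ ^ 2) * h1

lemma sum_dds (y x : E 4) : ∑ i, dds y x (ev i) =
    Real.exp ((1 - ‖x‖ ^ 2) / 2) * (8 - 4 * ⟪x - y, x⟫ - 4 * ‖x - y‖ ^ 2 + ‖x - y‖ ^ 2 * ‖x‖ ^ 2) := by
  have h2 := nsq x
  have h3 : ∀ i, ⟪ev i, ev i⟫ = (1:ℝ) := by intro i; simp [ev]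
  simp only [dds, h3]
  simp only [inner_ev, Fin.sum_univ_four]
  rw [inner_coord]
  set R := ‖x - y‖ ^ 2
  rw [h2]
  set τ := Real.exp ((1 - (x 0 ^ 2 + x 1 ^ 2 + x 2 ^ 2 + x 3 ^ 2)) / 2)
  ring

lemma dist_le_two (y x : E 4) (hx : ‖x‖ ≤ 1) (hy : ‖y‖ = 1) : ‖x - y‖ ≤ 2 := by
  have := norm_sub_le x y; linarith

lemma tau_bounds (y x : E 4) (hx : ‖x‖ ≤ 1) (hy : ‖y‖ = 1) :
    1 ≤ Real.exp ((1 - ‖x‖ ^ 2) / 2) ∧ Real.exp ((1 - ‖x‖ ^ 2) / 2) ≤ 2 ∧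
    Real.exp ((1 - ‖x‖ ^ 2) / 2) ≤ 1 + 2 * ‖x - y‖ := by
  have h0 := norm_nonneg x
  have h1 : 1 - ‖x‖ ≤ ‖x - y‖ := by
    have := norm_sub_norm_le y x
    rw [norm_sub_rev, hy] at this; exact this
  set t := (1 - ‖x‖ ^ 2) / 2 with ht
  have ht0 : 0 ≤ t := by rw [ht]; nlinarith
  have ht1 : t ≤ 1 / 2 := by rw [ht]; nlinarith
  have ht2 : t ≤ ‖x - y‖ := by rw [ht]; nlinarith
  have h3 : Real.exp t ≤ 1 + 2 * t := by
    have := Real.add_one_le_exp (-t)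
    rw [Real.exp_neg] at this
    have hp := Real.exp_pos t
    have h4 : (-t + 1) * Real.exp t ≤ 1 := by
      calc (-t + 1) * Real.exp t ≤ (Real.exp t)⁻¹ * Real.exp t := by gcongr
        _ = 1 := inv_mul_cancel₀ hp.ne'
    nlinarith
  exact ⟨Real.one_le_exp ht0, by linarith, by linarith⟩

lemma coord_le (a : E 4) (i : Fin 4) : |a i| ≤ ‖a‖ := by
  simpa using PiLp.norm_apply_le a i

lemma ds_bound (y x : E 4) (hx : ‖x‖ ≤ 1) (hy : ‖y‖ = 1) (i : Fin 4) : |ds y x (ev i)| ≤ 8 * ‖x - y‖ := by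
  obtain ⟨h1, h2, -⟩ := tau_bounds y x hx hy
  have h3 := dist_le_two y x hx hy
  have h4 := norm_nonneg (x - y)
  have h5 := coord_le (x - y) i
  have h6 := (coord_le x i).trans hx
  rw [ds, inner_ev, inner_ev, abs_mul, abs_of_pos (Real.exp_pos _)]
  have : |2 * (x - y) i - ‖x - y‖ ^ 2 * x i| ≤ 4 * ‖x - y‖ := by
    refine (abs_sub _ _).trans ?_
    rw [abs_mul, abs_mul, abs_two, abs_of_nonneg (sq_nonneg ‖x - y‖)]
    have : ‖x - y‖ ^ 2 * |x i| ≤ ‖x - y‖ ^ 2 * 1 := by gcongr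
    nlinarith
  calc _ ≤ 2 * (4 * ‖x - y‖) := by gcongr
    _ = _ := by ring

lemma dds_bound (y x : E 4) (hx : ‖x‖ ≤ 1) (hy : ‖y‖ = 1) (i : Fin 4) : |dds y x (ev i)| ≤ 40 := by
  obtain ⟨h1, h2, -⟩ := tau_bounds y x hx hy
  have h3 := dist_le_two y x hx hy
  have h4 := norm_nonneg (x - y)
  have h5 := abs_le.1 ((coord_le (x - y) i).trans h3)
  have h6 := abs_le.1 ((coord_le x i).trans hx)
  have h7 : ⟪ev i, ev i⟫ = (1:ℝ) := by simp [ev]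
  rw [dds, h7, inner_ev, inner_ev, abs_mul, abs_of_pos (Real.exp_pos _)]
  set p := (x - y) i
  set r := x i
  set R := ‖x - y‖
  have hR : R ^ 2 ≤ 4 := by nlinarith
  have hpr : |p * r| ≤ 2 := by rw [abs_mul]; have := abs_le.2 h5; have := abs_le.2 h6; nlinarith [abs_nonneg p, abs_nonneg r]
  have hr2 : r ^ 2 ≤ 1 := by nlinarith
  have : |2 * 1 - 2 * p * r - R ^ 2 * 1 - r * (2 * p - R ^ 2 * r)| ≤ 20 := by
    have := abs_le.1 hpr
    have hR0 := sq_nonneg R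
    have : R ^ 2 * r ^ 2 ≤ 4 := by nlinarith [sq_nonneg r]
    have : 0 ≤ R ^ 2 * r ^ 2 := by positivity
    rw [abs_le]; constructor <;> nlinarith
  calc _ ≤ 2 * (20:ℝ) := by gcongr
    _ = _ := by ring

lemma Af_lower (ε : ℝ) (y x : E 4) (hx : ‖x‖ ≤ 1) (hy : ‖y‖ = 1) : ε ^ 2 + ‖x - y‖ ^ 2 ≤ Af ε y x := by
  obtain ⟨h1, -, -⟩ := tau_bounds y x hx hy
  unfold Af sfun
  nlinarith [sq_nonneg ‖x - y‖]

lemma Af_upper (ε : ℝ) (hε : 0 < ε) (hε1 : ε ≤ 1) (y x : E 4) (hx : ‖x‖ ≤ 1) (hy : ‖y‖ = 1) : Af ε y x ≤ 9 := by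
  obtain ⟨h1, h2, -⟩ := tau_bounds y x hx hy
  have h3 := dist_le_two y x hx hy
  have h4 := norm_nonneg (x - y)
  unfold Af sfun
  have : ‖x - y‖ ^ 2 ≤ 4 := by nlinarith
  nlinarith [sq_nonneg ‖x - y‖]

lemma main_real (ε ρ A B : ℝ) (hε : 0 < ε) (hB1 : B ≤ (4 + 40 * ρ) * (ε ^ 2 + ρ ^ 2) + 4 * ε ^ 2)
    (hB0 : 0 ≤ B) (hAq : ε ^ 2 + ρ ^ 2 ≤ A) :
    B / A ^ 2 ≤ (4 + 40 * ρ) / (ε ^ 2 + ρ ^ 2) + 4 * ε ^ 2 / (ε ^ 2 + ρ ^ 2) ^ 2 := by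
  have hq : 0 < ε ^ 2 + ρ ^ 2 := by positivity
  have h1 : B / A ^ 2 ≤ B / (ε ^ 2 + ρ ^ 2) ^ 2 := by
    apply div_le_div_of_nonneg_left hB0 (by positivity)
    exact pow_le_pow_left₀ hq.le hAq 2
  refine h1.trans ?_
  have h2 : (4 + 40 * ρ) / (ε ^ 2 + ρ ^ 2) + 4 * ε ^ 2 / (ε ^ 2 + ρ ^ 2) ^ 2 =
    ((4 + 40 * ρ) * (ε ^ 2 + ρ ^ 2) + 4 * ε ^ 2) / (ε ^ 2 + ρ ^ 2) ^ 2 := by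
    rw [add_div ((4 + 40 * ρ) * (ε ^ 2 + ρ ^ 2)), sq (ε ^ 2 + ρ ^ 2), mul_div_mul_right _ _ hq.ne']
  rw [h2]
  exact div_le_div_of_nonneg_right hB1 (by positivity)

set_option maxHeartbeats 800000 in
/-- The explicit main term near a concentration point. -/
lemma main_term (ε : ℝ) (hε : 0 < ε) (y x : E 4) (hx : ‖x‖ ≤ 1) (hy : ‖y‖ = 1) (hρ : ‖x - y‖ ≤ 1) :
    |∑ i, (-(dds y x (ev i) / Af ε y x) + (ds y x (ev i) / Af ε y x) ^ 2)| ≤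
      (4 + 40 * ‖x - y‖) / (ε ^ 2 + ‖x - y‖ ^ 2) + 4 * ε ^ 2 / (ε ^ 2 + ‖x - y‖ ^ 2) ^ 2 := by
  obtain ⟨h1, h2, h3⟩ := tau_bounds y x hx hy
  have hA := Af_pos hε y x
  have hAq := Af_lower ε y x hx hy
  have e1 : ∑ i, (-(dds y x (ev i) / Af ε y x) + (ds y x (ev i) / Af ε y x) ^ 2)
      = -((∑ i, dds y x (ev i)) / Af ε y x) + (∑ i, ds y x (ev i) ^ 2) / Af ε y x ^ 2 := by
    simp only [Fin.sum_univ_four]; ring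
  have hc : |⟪x - y, x⟫| ≤ ‖x - y‖ := by
    refine (abs_real_inner_le_norm _ _).trans ?_
    nlinarith [norm_nonneg (x - y)]
  rw [e1, sum_ds_sq, sum_dds]
  have hAdef : Af ε y x = ε ^ 2 + ‖x - y‖ ^ 2 * Real.exp ((1 - ‖x‖ ^ 2) / 2) := rfl
  set A := Af ε y x
  set τ := Real.exp ((1 - ‖x‖ ^ 2) / 2)
  set c := ⟪x - y, x⟫
  set ρ := ‖x - y‖
  have hρ0 : 0 ≤ ρ := norm_nonneg _
  have hn0 := norm_nonneg x
  have hn : 0 ≤ ‖x‖ ^ 2 ∧ ‖x‖ ^ 2 ≤ 1 := ⟨by positivity, by nlinarith⟩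
  set n := ‖x‖ ^ 2
  have hc' := abs_le.1 hc
  set B := ε ^ 2 * τ * (8 - 4 * c - 4 * ρ ^ 2 + ρ ^ 2 * n) + 4 * ρ ^ 2 * τ ^ 2 * (1 - ρ ^ 2) with hB
  have e2 : -(τ * (8 - 4 * c - 4 * ρ ^ 2 + ρ ^ 2 * n) / A) + τ ^ 2 * ρ ^ 2 * (4 - 4 * c + ρ ^ 2 * n) / A ^ 2
      = - (B / A ^ 2) := by
    field_simp
    rw [hB, hAdef]; ring
  have hρ2 : 0 ≤ ρ ^ 2 := by positivity
  have hρ1 : ρ ^ 2 ≤ ρ := by nlinarith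
  have hm0 : 0 ≤ 8 - 4 * c - 4 * ρ ^ 2 + ρ ^ 2 * n := by nlinarith
  have hm1 : 8 - 4 * c - 4 * ρ ^ 2 + ρ ^ 2 * n ≤ 8 + 5 * ρ := by nlinarith
  have hB0 : 0 ≤ B := by
    have : 0 ≤ 1 - ρ ^ 2 := by nlinarith
    positivity
  have hB1 : B ≤ (4 + 40 * ρ) * (ε ^ 2 + ρ ^ 2) + 4 * ε ^ 2 := by
    have i1 : τ * (8 - 4 * c - 4 * ρ ^ 2 + ρ ^ 2 * n) ≤ (1 + 2 * ρ) * (8 + 5 * ρ) := by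
      gcongr
    have i2 : τ ^ 2 * (1 - ρ ^ 2) ≤ (1 + 2 * ρ) ^ 2 * 1 := by
      gcongr
      · linarith
      · linarith
    have i3 : ε ^ 2 * (τ * (8 - 4 * c - 4 * ρ ^ 2 + ρ ^ 2 * n)) ≤ ε ^ 2 * (8 + 40 * ρ) := by
      gcongr; nlinarith
    have i4 : ρ ^ 2 * (4 * (τ ^ 2 * (1 - ρ ^ 2))) ≤ ρ ^ 2 * (4 + 40 * ρ) := by
      gcongr; nlinarith
    rw [hB]; nlinarith
  rw [e2, abs_neg, abs_of_nonneg (by positivity)]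
  exact main_real ε ρ A B hε hB1 hB0 hAq

lemma avg_close {ι : Type*} (T : Finset ι) (π Z : ι → ℝ) (B : ℝ) (κ : ι) (hκ : κ ∈ T)
    (hπ : ∀ y ∈ T, 0 ≤ π y) (hs : ∑ y ∈ T, π y = 1) (hZ : ∀ y ∈ T, |Z y| ≤ B) :
    |∑ y ∈ T, π y * Z y - Z κ| ≤ 2 * B * (1 - π κ) := by
  classical
  have h1 : ∑ y ∈ T, π y * Z y - Z κ = ∑ y ∈ T.erase κ, π y * (Z y - Z κ) := by
    have : ∑ y ∈ T.erase κ, π y * (Z y - Z κ) = ∑ y ∈ T, π y * (Z y - Z κ) := by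
      rw [← Finset.add_sum_erase T _ hκ]; simp
    rw [this]
    simp_rw [mul_sub]
    rw [Finset.sum_sub_distrib, ← Finset.sum_mul, hs, one_mul]
  have h2 : 1 - π κ = ∑ y ∈ T.erase κ, π y := by
    rw [← hs, ← Finset.add_sum_erase T _ hκ]; ring
  rw [h1, h2, Finset.mul_sum]
  refine (Finset.abs_sum_le_sum_abs _ _).trans (Finset.sum_le_sum fun y hy => ?_)
  have hy' := Finset.mem_of_mem_erase hy
  rw [abs_mul, abs_of_nonneg (hπ y hy')]
  have : |Z y - Z κ| ≤ 2 * B := by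
    refine (abs_sub _ _).trans ?_
    linarith [hZ y hy', hZ κ hκ]
  nlinarith [hπ y hy']

lemma avg_bound {ι : Type*} (T : Finset ι) (π Z : ι → ℝ) (B : ℝ)
    (hπ : ∀ y ∈ T, 0 ≤ π y) (hs : ∑ y ∈ T, π y = 1) (hZ : ∀ y ∈ T, |Z y| ≤ B) :
    |∑ y ∈ T, π y * Z y| ≤ B := by
  refine (Finset.abs_sum_le_sum_abs _ _).trans ?_
  calc _ ≤ ∑ y ∈ T, π y * B := by
        refine Finset.sum_le_sum fun y hy => ?_
        rw [abs_mul, abs_of_nonneg (hπ y hy)]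
        exact mul_le_mul_of_nonneg_left (hZ y hy) (hπ y hy)
    _ = B := by rw [← Finset.sum_mul, hs, one_mul]

lemma comb_close {ι : Type*} (T : Finset ι) (π X Y : ι → ℝ) (M M' : ℝ) (κ : ι) (hκ : κ ∈ T)
    (hπ : ∀ y ∈ T, 0 ≤ π y) (hs : ∑ y ∈ T, π y = 1) (hX : ∀ y ∈ T, |X y| ≤ M) (hY : ∀ y ∈ T, |Y y| ≤ M') :
    |(-(∑ y ∈ T, π y * Y y) + 4 * ∑ y ∈ T, π y * X y ^ 2 - 3 * (∑ y ∈ T, π y * X y) ^ 2)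
      - (-Y κ + X κ ^ 2)| ≤ (2 * M' + 20 * M ^ 2) * (1 - π κ) := by
  have hM : 0 ≤ M := (abs_nonneg _).trans (hX κ hκ)
  have hX2 : ∀ y ∈ T, |X y ^ 2| ≤ M ^ 2 := fun y hy => by
    rw [abs_pow]; gcongr; exact hX y hy
  have h1 := avg_close T π Y M' κ hκ hπ hs hY
  have h2 := avg_close T π (fun y => X y ^ 2) (M ^ 2) κ hκ hπ hs hX2
  have h3 := avg_close T π X M κ hκ hπ hs hX
  have h4 := avg_bound T π X M hπ hs hX
  set a := ∑ y ∈ T, π y * Y y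
  set b := ∑ y ∈ T, π y * X y ^ 2
  set c := ∑ y ∈ T, π y * X y
  have h5 : |c ^ 2 - X κ ^ 2| ≤ 2 * M * (1 - π κ) * (2 * M) := by
    rw [show c ^ 2 - X κ ^ 2 = (c - X κ) * (c + X κ) by ring, abs_mul]
    have : |c + X κ| ≤ 2 * M := (abs_add_le _ _).trans (by linarith [hX κ hκ])
    exact mul_le_mul h3 this (abs_nonneg _) ((abs_nonneg _).trans h3)
  rw [abs_le] at *
  constructor <;> nlinarith

lemma comb_bound {ι : Type*} (T : Finset ι) (π X Y : ι → ℝ) (M M' : ℝ)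
    (hπ : ∀ y ∈ T, 0 ≤ π y) (hs : ∑ y ∈ T, π y = 1) (hX : ∀ y ∈ T, |X y| ≤ M) (hY : ∀ y ∈ T, |Y y| ≤ M') :
    |-(∑ y ∈ T, π y * Y y) + 4 * ∑ y ∈ T, π y * X y ^ 2 - 3 * (∑ y ∈ T, π y * X y) ^ 2| ≤ M' + 7 * M ^ 2 := by
  have hX2 : ∀ y ∈ T, |X y ^ 2| ≤ M ^ 2 := fun y hy => by
    rw [abs_pow]; gcongr; exact hX y hy
  have h1 := avg_bound T π Y M' hπ hs hY
  have h2 := avg_bound T π (fun y => X y ^ 2) (M ^ 2) hπ hs hX2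
  have h4 := avg_bound T π X M hπ hs hX
  have h5 := pow_le_pow_left₀ (abs_nonneg _) h4 2
  rw [sq_abs] at h5
  have h6 := sq_nonneg (∑ y ∈ T, π y * X y)
  rw [abs_le] at *
  constructor <;> nlinarith

/-- Normalised weight of a bubble. -/
def pw (ε : ℝ) (T : Finset (E 4)) (W : E 4 → ℝ) (x y : E 4) : ℝ :=
  W y * (Af ε y x ^ 3)⁻¹ / Phi ε T W x

lemma pw_nonneg {ε : ℝ} (hε : 0 < ε) {T : Finset (E 4)} {W : E 4 → ℝ} (hT : T.Nonempty)
    (hW : ∀ y ∈ T, 0 < W y) (x : E 4) : ∀ y ∈ T, 0 ≤ pw ε T W x y := by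
  intro y hy
  have h1 := Phi_pos hε hT hW x
  have h2 := Af_pos hε y x
  have h3 := hW y hy
  unfold pw; positivity

lemma pw_sum {ε : ℝ} (hε : 0 < ε) {T : Finset (E 4)} {W : E 4 → ℝ} (hT : T.Nonempty)
    (hW : ∀ y ∈ T, 0 < W y) (x : E 4) : ∑ y ∈ T, pw ε T W x y = 1 := by
  unfold pw
  rw [← Finset.sum_div]
  exact div_self (Phi_pos hε hT hW x).ne'

lemma Psi_div {ε : ℝ} (hε : 0 < ε) (T : Finset (E 4)) (W : E 4 → ℝ) (x v : E 4) :
    Psi ε T W x v / Phi ε T W x = ∑ y ∈ T, pw ε T W x y * (ds y x v / Af ε y x) := by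
  unfold Psi pw
  rw [Finset.sum_div]
  refine Finset.sum_congr rfl fun y hy => ?_
  have := (Af_pos hε y x).ne'
  have e : (Af ε y x ^ 4)⁻¹ = (Af ε y x ^ 3)⁻¹ * (Af ε y x)⁻¹ := by
    rw [← mul_inv]; ring
  rw [e]; ring

lemma d2_eq {ε : ℝ} (hε : 0 < ε) {T : Finset (E 4)} {W : E 4 → ℝ} (hT : T.Nonempty)
    (hW : ∀ y ∈ T, 0 < W y) (x v : E 4) :
    fderiv ℝ (fun z => fderiv ℝ (uf ε T W) z v) x v =
      -(∑ y ∈ T, pw ε T W x y * (dds y x v / Af ε y x))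
      + 4 * ∑ y ∈ T, pw ε T W x y * (ds y x v / Af ε y x) ^ 2
      - 3 * (∑ y ∈ T, pw ε T W x y * (ds y x v / Af ε y x)) ^ 2 := by
  rw [uf_fderiv2 hε hT hW, Psi_div hε]
  have e : (∑ y ∈ T, (W y * (Af ε y x ^ 4)⁻¹ * dds y x v
        - 4 * (W y * (Af ε y x ^ 5)⁻¹ * ds y x v ^ 2))) / Phi ε T W x =
      ∑ y ∈ T, pw ε T W x y * (dds y x v / Af ε y x)
      - 4 * ∑ y ∈ T, pw ε T W x y * (ds y x v / Af ε y x) ^ 2 := by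
    rw [Finset.mul_sum, ← Finset.sum_sub_distrib, Finset.sum_div]
    refine Finset.sum_congr rfl fun y hy => ?_
    have e : (Af ε y x ^ 4)⁻¹ = (Af ε y x ^ 3)⁻¹ * (Af ε y x)⁻¹ := by
      rw [← mul_inv]; ring
    have e' : (Af ε y x ^ 5)⁻¹ = (Af ε y x ^ 3)⁻¹ * (Af ε y x)⁻¹ ^ 2 := by
      rw [← inv_pow, ← inv_pow]; ring
    unfold pw
    rw [e, e', div_pow]; ring
  rw [e]; ring

lemma X_bound {ε : ℝ} (hε : 0 < ε) (y x : E 4) (hx : ‖x‖ ≤ 1) (hy : ‖y‖ = 1) (i : Fin 4) :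
    |ds y x (ev i) / Af ε y x| ≤ 16 / Af ε y x := by
  have hA := Af_pos hε y x
  rw [abs_div, abs_of_pos hA]
  have := ds_bound y x hx hy i
  have := dist_le_two y x hx hy
  gcongr; linarith

lemma Y_bound {ε : ℝ} (hε : 0 < ε) (y x : E 4) (hx : ‖x‖ ≤ 1) (hy : ‖y‖ = 1) (i : Fin 4) :
    |dds y x (ev i) / Af ε y x| ≤ 40 / Af ε y x := by
  have hA := Af_pos hε y x
  rw [abs_div, abs_of_pos hA]
  have := dds_bound y x hx hy i
  gcongr

lemma Af_far {ε δ : ℝ} (y x : E 4) (hx : ‖x‖ ≤ 1) (hy : ‖y‖ = 1) (hδ : 0 < δ)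
    (h : δ ≤ ‖x - y‖) : δ ^ 2 ≤ Af ε y x := by
  have := Af_lower ε y x hx hy
  have : δ ^ 2 ≤ ‖x - y‖ ^ 2 := by gcongr
  nlinarith [sq_nonneg ε]

lemma lap_far {ε δ : ℝ} (hε : 0 < ε) {T : Finset (E 4)} {W : E 4 → ℝ} (hT : T.Nonempty)
    (hW : ∀ y ∈ T, 0 < W y) (hT1 : ∀ y ∈ T, ‖y‖ = 1) (x : E 4) (hx : ‖x‖ ≤ 1) (hδ : 0 < δ)
    (hδ1 : δ ≤ 1) (hfar : ∀ y ∈ T, δ ≤ ‖x - y‖) : |lap 4 (uf ε T W) x| ≤ 10000 / δ ^ 4 := by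
  have key : ∀ i : Fin 4, |fderiv ℝ (fun z => fderiv ℝ (uf ε T W) z (ev i)) x (ev i)| ≤ 2500 / δ ^ 4 := by
    intro i
    rw [d2_eq hε hT hW]
    refine (comb_bound T (pw ε T W x) (fun y => ds y x (ev i) / Af ε y x)
      (fun y => dds y x (ev i) / Af ε y x) (16 / δ ^ 2) (40 / δ ^ 2) (pw_nonneg hε hT hW x)
      (pw_sum hε hT hW x) ?_ ?_).trans ?_
    · intro y hy
      refine (X_bound hε y x hx (hT1 y hy) i).trans ?_
      have := Af_far (ε := ε) y x hx (hT1 y hy) hδ (hfar y hy)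
      gcongr
    · intro y hy
      refine (Y_bound hε y x hx (hT1 y hy) i).trans ?_
      have := Af_far (ε := ε) y x hx (hT1 y hy) hδ (hfar y hy)
      gcongr
    · have h1 : 40 / δ ^ 2 ≤ 40 / δ ^ 4 := by
        apply div_le_div_of_nonneg_left (by norm_num) (by positivity)
        exact pow_le_pow_of_le_one hδ.le hδ1 (by norm_num)
      have h2 : 7 * (16 / δ ^ 2) ^ 2 = 1792 / δ ^ 4 := by
        rw [div_pow, ← pow_mul]; ring
      rw [h2]
      calc _ ≤ 40 / δ ^ 4 + 1792 / δ ^ 4 := by linarith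
        _ = 1832 / δ ^ 4 := by ring
        _ ≤ _ := by gcongr; norm_num
  unfold lap
  refine (Finset.abs_sum_le_sum_abs _ _).trans ?_
  refine (Finset.sum_le_sum fun i _ => key i).trans ?_
  simp; apply le_of_eq; ring

lemma one_sub_pw {ε δ w : ℝ} (hε : 0 < ε) {T : Finset (E 4)} {W : E 4 → ℝ} 
    (hW : ∀ y ∈ T, 0 < W y) (hs : ∑ y ∈ T, W y = 1) (hT1 : ∀ y ∈ T, ‖y‖ = 1) (x : E 4)
    (hx : ‖x‖ ≤ 1) (hδ : 0 < δ) (κ : E 4) (hκ : κ ∈ T)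
    (hfar : ∀ y ∈ T, y ≠ κ → δ ≤ ‖x - y‖) (hw : 0 < w) (hwκ : w ≤ W κ) :
    1 - pw ε T W x κ ≤ Af ε κ x ^ 3 / (w * δ ^ 6) := by
  classical
  have hT : T.Nonempty := ⟨κ, hκ⟩
  have hΦ := Phi_pos hε hT hW x
  have hAκ := Af_pos hε κ x
  have h1 : 1 - pw ε T W x κ = (∑ y ∈ T.erase κ, W y * (Af ε y x ^ 3)⁻¹) / Phi ε T W x := by
    rw [← pw_sum hε hT hW x, ← Finset.add_sum_erase T _ hκ, Finset.sum_div]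
    simp [pw]
  have h2 : ∑ y ∈ T.erase κ, W y * (Af ε y x ^ 3)⁻¹ ≤ (δ ^ 6)⁻¹ := by
    calc _ ≤ ∑ y ∈ T.erase κ, W y * (δ ^ 6)⁻¹ := by
          refine Finset.sum_le_sum fun y hy => ?_
          have hy' := Finset.mem_of_mem_erase hy
          have := Af_far (ε := ε) y x hx (hT1 y hy') hδ (hfar y hy' (Finset.ne_of_mem_erase hy))
          have h3 : δ ^ 6 ≤ Af ε y x ^ 3 := by
            calc δ ^ 6 = (δ ^ 2) ^ 3 := by ring
              _ ≤ _ := by gcongr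
          have := (hW y hy').le
          gcongr
      _ ≤ ∑ y ∈ T, W y * (δ ^ 6)⁻¹ := by
          refine Finset.sum_le_sum_of_subset_of_nonneg (Finset.erase_subset _ _) fun y hy _ => ?_
          have := hW y hy
          positivity
      _ = _ := by rw [← Finset.sum_mul, hs, one_mul]
  have h3 : w * (Af ε κ x ^ 3)⁻¹ ≤ Phi ε T W x := by
    refine le_trans ?_ (Finset.single_le_sum (f := fun y => W y * (Af ε y x ^ 3)⁻¹) (fun y hy => ?_) hκ)
    · gcongr
    · have := hW y hy
      have := Af_pos hε y x
      positivity
  rw [h1]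
  calc _ ≤ (δ ^ 6)⁻¹ / (w * (Af ε κ x ^ 3)⁻¹) := by gcongr
    _ = _ := by field_simp

lemma lap_near {ε δ w : ℝ} (hε : 0 < ε) (hε1 : ε ≤ 1) {T : Finset (E 4)} {W : E 4 → ℝ} 
    (hW : ∀ y ∈ T, 0 < W y) (hs : ∑ y ∈ T, W y = 1) (hT1 : ∀ y ∈ T, ‖y‖ = 1) (x : E 4)
    (hx : ‖x‖ ≤ 1) (hδ : 0 < δ) (hδ1 : δ ≤ 1) (κ : E 4) (hκ : κ ∈ T)
    (hfar : ∀ y ∈ T, y ≠ κ → δ ≤ ‖x - y‖) (hw : 0 < w) (hwκ : w ≤ W κ) :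
    |lap 4 (uf ε T W) x - ∑ i, (-(dds κ x (ev i) / Af ε κ x) + (ds κ x (ev i) / Af ε κ x) ^ 2)|
      ≤ 16000000 / (w * δ ^ 10) := by
  have hT : T.Nonempty := ⟨κ, hκ⟩
  have hA := Af_pos hε κ x
  have hA9 := Af_upper ε hε hε1 κ x hx (hT1 κ hκ)
  have hpw := one_sub_pw hε hW hs hT1 x hx hδ κ hκ hfar hw hwκ
  have hd2 : δ ^ 2 ≤ 1 := pow_le_one₀ hδ.le hδ1
  have gen : ∀ y ∈ T, ∀ c : ℝ, 0 ≤ c → c / Af ε y x ≤ 9 * c / (δ ^ 2 * Af ε κ x) := by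
    intro y hy c hc
    by_cases h : y = κ
    · subst h
      rw [div_le_div_iff₀ hA (by positivity)]
      have : c * Af ε y x * δ ^ 2 ≤ c * Af ε y x * 9 := by gcongr; linarith
      nlinarith
    · have h2 := Af_far (ε := ε) y x hx (hT1 y hy) hδ (hfar y hy h)
      rw [div_le_div_iff₀ (Af_pos hε y x) (by positivity)]
      have h3 := (Af_pos hε y x).le
      have : c * (δ ^ 2 * Af ε κ x) ≤ c * (Af ε y x * 9) := by gcongr
      nlinarith
  have key : ∀ i : Fin 4, |fderiv ℝ (fun z => fderiv ℝ (uf ε T W) z (ev i)) x (ev i)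
      - (-(dds κ x (ev i) / Af ε κ x) + (ds κ x (ev i) / Af ε κ x) ^ 2)| ≤ 4000000 / (w * δ ^ 10) := by
    intro i
    rw [d2_eq hε hT hW]
    refine (comb_close T (pw ε T W x) (fun y => ds y x (ev i) / Af ε y x)
      (fun y => dds y x (ev i) / Af ε y x) (9 * 16 / (δ ^ 2 * Af ε κ x)) (9 * 40 / (δ ^ 2 * Af ε κ x))
      κ hκ (pw_nonneg hε hT hW x)
      (pw_sum hε hT hW x) ?_ ?_).trans ?_
    · intro y hy
      exact (X_bound hε y x hx (hT1 y hy) i).trans (gen y hy 16 (by norm_num))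
    · intro y hy
      exact (Y_bound hε y x hx (hT1 y hy) i).trans (gen y hy 40 (by norm_num))
    · set A := Af ε κ x
      calc _ ≤ (2 * (9 * 40 / (δ ^ 2 * A)) + 20 * (9 * 16 / (δ ^ 2 * A)) ^ 2) * (A ^ 3 / (w * δ ^ 6)) := by
            gcongr
        _ = (720 * (A ^ 2 * δ ^ 2) + 414720 * A) / (w * δ ^ 10) := by field_simp; ring
        _ ≤ (720 * (9 ^ 2 * 1) + 414720 * 9) / (w * δ ^ 10) := by gcongr
        _ ≤ _ := by gcongr; norm_num
  unfold lap
  rw [← Finset.sum_sub_distrib]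
  refine (Finset.abs_sum_le_sum_abs _ _).trans ?_
  refine (Finset.sum_le_sum fun i _ => key i).trans ?_
  simp; apply le_of_eq; ring

lemma sq_alg (η ε q P D l : ℝ) (hη : 0 < η) (hη1 : η ≤ 1) (hε : 0 < ε) (hq : ε ^ 2 ≤ q) 
    (hP : P = (4 + 40 * η) / q + 4 * ε ^ 2 / q ^ 2) (hl : |l| ≤ P + D) :
    l ^ 2 ≤ (1 + 1 / η) * D ^ 2 + ((1 + η) * (4 + 40 * η) ^ 2 / q ^ 2 + 1000 * ε ^ 2 / q ^ 3) := by
  have hq0 : 0 < q := lt_of_lt_of_le (by positivity) hq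
  have h1 : l ^ 2 ≤ (P + D) ^ 2 := by
    rw [← sq_abs l]; exact pow_le_pow_left₀ (abs_nonneg _) hl 2
  have h2 : (P + D) ^ 2 ≤ (1 + η) * P ^ 2 + (1 + 1 / η) * D ^ 2 := by
    have : 0 ≤ (η * P - D) ^ 2 / η := by positivity
    have e : (η * P - D) ^ 2 / η = η * P ^ 2 - 2 * P * D + D ^ 2 / η := by field_simp; ring
    rw [e] at this
    have e2 : (1 + 1 / η) * D ^ 2 = D ^ 2 + D ^ 2 / η := by ring
    rw [e2]; nlinarith
  have h3 : P ^ 2 ≤ (4 + 40 * η) ^ 2 / q ^ 2 + 368 * ε ^ 2 / q ^ 3 := by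
    have e : P ^ 2 = (4 + 40 * η) ^ 2 / q ^ 2 + (8 * (4 + 40 * η) + 16 * (ε ^ 2 / q)) * ε ^ 2 / q ^ 3 := by
      rw [hP]; field_simp; ring
    have : ε ^ 2 / q ≤ 1 := by rw [div_le_one hq0]; exact hq
    rw [e]; gcongr; linarith
  have h4 : (1 + η) * P ^ 2 ≤ (1 + η) * ((4 + 40 * η) ^ 2 / q ^ 2 + 368 * ε ^ 2 / q ^ 3) := by gcongr
  have h5 : (1 + η) * (368 * ε ^ 2 / q ^ 3) ≤ 1000 * ε ^ 2 / q ^ 3 := by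
    have : 0 ≤ ε ^ 2 / q ^ 3 := by positivity
    have e : (1 + η) * (368 * ε ^ 2 / q ^ 3) = ((1 + η) * 368) * (ε ^ 2 / q ^ 3) := by ring
    have e' : 1000 * ε ^ 2 / q ^ 3 = 1000 * (ε ^ 2 / q ^ 3) := by ring
    rw [e, e']; gcongr; linarith
  have e6 : (1 + η) * (4 + 40 * η) ^ 2 / q ^ 2 = (1 + η) * ((4 + 40 * η) ^ 2 / q ^ 2) := by ring
  rw [e6]; nlinarith

lemma sep_exists (T : Finset (E 4)) : ∃ d > 0, ∀ y ∈ T, ∀ z ∈ T, y ≠ z → d ≤ ‖y - z‖ := by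
  classical
  obtain h | h := T.offDiag.eq_empty_or_nonempty
  · refine ⟨1, one_pos, fun y hy z hz hyz => ?_⟩
    have : (y, z) ∈ T.offDiag := by simp [hy, hz, hyz]
    simp [h] at this
  · obtain ⟨p, hp, hm⟩ := T.offDiag.exists_min_image (fun p => ‖p.1 - p.2‖) h
    simp at hp
    refine ⟨‖p.1 - p.2‖, norm_pos_iff.2 (sub_ne_zero.2 hp.2.2), fun y hy z hz hyz => ?_⟩
    exact hm (y, z) (by simp [hy, hz, hyz])

lemma lap_bound {T : Finset (E 4)} {W : E 4 → ℝ} (hT : T.Nonempty)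
    (hW : ∀ y ∈ T, 0 < W y) (hs : ∑ y ∈ T, W y = 1) (hT1 : ∀ y ∈ T, ‖y‖ = 1) (η : ℝ) (hη : 0 < η)
    (hη1 : η ≤ 1) : ∃ C ≥ 0, ∀ ε : ℝ, 0 < ε → ε ≤ 1 → ∀ x : E 4, ‖x‖ ≤ 1 →
      (lap 4 (uf ε T W) x) ^ 2 ≤ C + ∑ y ∈ T, ((1 + η) * (4 + 40 * η) ^ 2 / (ε ^ 2 + ‖x - y‖ ^ 2) ^ 2
        + 1000 * ε ^ 2 / (ε ^ 2 + ‖x - y‖ ^ 2) ^ 3) := by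
  obtain ⟨d, hd, hsep⟩ := sep_exists T
  obtain ⟨y0, hy0, hmin⟩ := T.exists_min_image W hT
  have hw := hW y0 hy0
  have hw1 : W y0 ≤ 1 := by
    rw [← hs]; exact Finset.single_le_sum (fun y hy => (hW y hy).le) hy0
  set w := W y0
  obtain ⟨δ, hδ, hδη, hδd, hδ1⟩ : ∃ δ > 0, δ ≤ η ∧ δ ≤ d / 2 ∧ δ ≤ 1 :=
    ⟨min η (d / 2), by positivity, min_le_left _ _, min_le_right _ _, (min_le_left _ _).trans hη1⟩
  set D := 16000000 / (w * δ ^ 10) with hD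
  have hD0 : 0 ≤ D := by positivity
  refine ⟨(1 + 1 / η) * D ^ 2, by positivity, fun ε hε hε1 x hx => ?_⟩
  have hnn : ∀ y ∈ T, 0 ≤ ((1 + η) * (4 + 40 * η) ^ 2 / (ε ^ 2 + ‖x - y‖ ^ 2) ^ 2
        + 1000 * ε ^ 2 / (ε ^ 2 + ‖x - y‖ ^ 2) ^ 3) := fun y _ => by positivity
  by_cases hfar : ∀ y ∈ T, δ ≤ ‖x - y‖
  · have h1 := lap_far hε hT hW hT1 x hx hδ hδ1 hfar
    have h2 : 10000 / δ ^ 4 ≤ D := by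
      rw [hD]
      apply div_le_div₀ (by norm_num) (by norm_num) (by positivity)
      calc w * δ ^ 10 ≤ 1 * δ ^ 4 := by
            gcongr ?_ * ?_
            exact pow_le_pow_of_le_one hδ.le hδ1 (by norm_num)
        _ = _ := one_mul _
    have h3 : (lap 4 (uf ε T W) x) ^ 2 ≤ D ^ 2 := by
      rw [← sq_abs]; exact pow_le_pow_left₀ (abs_nonneg _) (h1.trans h2) 2
    have h4 := Finset.sum_nonneg hnn
    have h5 : 0 ≤ 1 / η * D ^ 2 := by positivity
    nlinarith
  · push Not at hfar
    obtain ⟨κ, hκ, hρ⟩ := hfar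
    have hf : ∀ y ∈ T, y ≠ κ → δ ≤ ‖x - y‖ := by
      intro y hy hne
      have h1 := hsep y hy κ hκ hne
      have h2 : ‖y - κ‖ ≤ ‖x - y‖ + ‖x - κ‖ := by
        rw [show y - κ = (x - κ) - (x - y) by abel]
        linarith [norm_sub_le (x - κ) (x - y)]
      linarith
    have h1 := lap_near hε hε1 hW hs hT1 x hx hδ hδ1 κ hκ hf hw (hmin κ hκ)
    have h2 := main_term ε hε κ x hx (hT1 κ hκ) (hρ.le.trans hδ1)
    have h3 := Finset.single_le_sum hnn hκ
    refine le_trans (sq_alg η ε (ε ^ 2 + ‖x - κ‖ ^ 2) _ D _ hη hη1 hε (by nlinarith [sq_nonneg ‖x - κ‖]) rfl ?_)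
      (add_le_add le_rfl h3)
    have h4 : (4 + 40 * ‖x - κ‖) / (ε ^ 2 + ‖x - κ‖ ^ 2) ≤ (4 + 40 * η) / (ε ^ 2 + ‖x - κ‖ ^ 2) := by
      gcongr; linarith
    have h5 := abs_sub_abs_le_abs_sub (lap 4 (uf ε T W) x) (∑ i, (-(dds κ x (ev i) / Af ε κ x) + (ds κ x (ev i) / Af ε κ x) ^ 2))
    linarith

lemma q_cont {ε : ℝ} (hε : 0 < ε) (y : E 4) : Continuous fun x : E 4 => 1 / (ε ^ 2 + ‖x - y‖ ^ 2) :=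
  continuous_const.div (by fun_prop) fun x => by positivity

lemma sum_q_cont {ε : ℝ} (hε : 0 < ε) (T : Finset (E 4)) :
    Continuous fun x : E 4 => ∑ y ∈ T, 1 / (ε ^ 2 + ‖x - y‖ ^ 2) :=
  continuous_finsetSum _ fun y _ => q_cont hε y

lemma sum_q_integral {ε : ℝ} (hε : 0 < ε) (T : Finset (E 4)) (hT1 : ∀ y ∈ T, ‖y‖ = 1) :
    ∫ x, ∑ y ∈ T, 1 / (ε ^ 2 + ‖x - y‖ ^ 2) ∂(sphMeasure 4) ≤ T.card * (2 * Real.pi ^ 2 + 128) := by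
  rw [integral_finsetSum _ fun y _ => sph_integrable (q_cont hε y)]
  refine (Finset.sum_le_sum fun y hy => sph_inv_sq_bound y (hT1 y hy) ε hε).trans ?_
  rw [Finset.sum_const, nsmul_eq_mul]

lemma uf_upper {ε : ℝ} (hε : 0 < ε) {T : Finset (E 4)} {W : E 4 → ℝ} (hT : T.Nonempty)
    (hW : ∀ y ∈ T, 0 < W y) (hs : ∑ y ∈ T, W y = 1) (x : E 4) (hx : ‖x‖ = 1) :
    uf ε T W x ≤ ∑ y ∈ T, 1 / (ε ^ 2 + ‖x - y‖ ^ 2) := by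
  have hA : ∀ y, Af ε y x = ε ^ 2 + ‖x - y‖ ^ 2 := fun y => by rw [Af, sfun_sphere y x hx]
  set S := ∑ y ∈ T, 1 / (ε ^ 2 + ‖x - y‖ ^ 2) with hS
  have hS0 : 0 < S := Finset.sum_pos (fun y _ => by positivity) hT
  have h1 : Phi ε T W x ≤ S ^ 3 := by
    calc Phi ε T W x ≤ ∑ y ∈ T, W y * S ^ 3 := by
          refine Finset.sum_le_sum fun y hy => ?_
          have h2 : 1 / (ε ^ 2 + ‖x - y‖ ^ 2) ≤ S :=
            Finset.single_le_sum (f := fun y => 1 / (ε ^ 2 + ‖x - y‖ ^ 2)) (fun y _ => by positivity) hy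
          rw [hA, ← inv_pow, ← one_div]
          have := (hW y hy).le
          gcongr
      _ = _ := by rw [← Finset.sum_mul, hs, one_mul]
  have h2 := Real.log_le_log (Phi_pos hε hT hW x) h1
  rw [Real.log_pow] at h2
  have h3 := Real.log_le_sub_one_of_pos hS0
  unfold uf
  push_cast at h2
  linarith

lemma uf_mean {ε : ℝ} (hε : 0 < ε) {T : Finset (E 4)} {W : E 4 → ℝ} (hT : T.Nonempty)
    (hW : ∀ y ∈ T, 0 < W y) (hs : ∑ y ∈ T, W y = 1) (hT1 : ∀ y ∈ T, ‖y‖ = 1) :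
    ∫ x, uf ε T W x ∂(sphMeasure 4) ≤ T.card * (2 * Real.pi ^ 2 + 128) := by
  refine le_trans (integral_mono_ae (sph_integrable (uf_smooth hε hT hW).continuous)
    (sph_integrable (sum_q_cont hε T)) ?_) (sum_q_integral hε T hT1)
  filter_upwards [sph_ae] with x hx
  exact uf_upper hε hT hW hs x hx

lemma grad_sq (f : E 4 → ℝ) (x : E 4) : ‖gradient f x‖ ^ 2 = ∑ i, (fderiv ℝ f x (ev i)) ^ 2 := by
  have h : ∀ i, (gradient f x) i = fderiv ℝ f x (ev i) := by
    intro i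
    rw [← inner_ev]
    simp [gradient]
  rw [nsq, Fin.sum_univ_four, h, h, h, h]

lemma fderiv_sq_bound {ε : ℝ} (hε : 0 < ε) {T : Finset (E 4)} {W : E 4 → ℝ} (hT : T.Nonempty)
    (hW : ∀ y ∈ T, 0 < W y) (hT1 : ∀ y ∈ T, ‖y‖ = 1) (x : E 4) (hx : ‖x‖ ≤ 1) (i : Fin 4) :
    (fderiv ℝ (uf ε T W) x (ev i)) ^ 2 ≤ 64 * ∑ y ∈ T, 1 / (ε ^ 2 + ‖x - y‖ ^ 2) := by
  set S := ∑ y ∈ T, 1 / (ε ^ 2 + ‖x - y‖ ^ 2) with hS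
  have hS0 : 0 ≤ S := Finset.sum_nonneg (fun y _ => by positivity)
  rw [uf_fderiv hε hT hW, Psi_div hε, neg_sq]
  have := avg_bound T (pw ε T W x) (fun y => ds y x (ev i) / Af ε y x) (Real.sqrt (64 * S))
    (pw_nonneg hε hT hW x) (pw_sum hε hT hW x) ?_
  · have h2 := pow_le_pow_left₀ (abs_nonneg _) this 2
    rwa [sq_abs, Real.sq_sqrt (by positivity)] at h2
  · intro y hy
    apply Real.abs_le_sqrt
    have h1 : 1 / (ε ^ 2 + ‖x - y‖ ^ 2) ≤ S :=
      Finset.single_le_sum (f := fun y => 1 / (ε ^ 2 + ‖x - y‖ ^ 2)) (fun y _ => by positivity) hy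
    have h2 := Af_lower ε y x hx (hT1 y hy)
    have h3 := ds_bound y x hx (hT1 y hy) i
    have hq : 0 < ε ^ 2 + ‖x - y‖ ^ 2 := by positivity
    have h4 : ds y x (ev i) ^ 2 ≤ 64 * (ε ^ 2 + ‖x - y‖ ^ 2) := by
      rw [← sq_abs]
      have := pow_le_pow_left₀ (abs_nonneg _) h3 2
      nlinarith [sq_nonneg ε]
    calc (ds y x (ev i) / Af ε y x) ^ 2 = ds y x (ev i) ^ 2 / Af ε y x ^ 2 := div_pow _ _ _
      _ ≤ 64 * (ε ^ 2 + ‖x - y‖ ^ 2) / (ε ^ 2 + ‖x - y‖ ^ 2) ^ 2 := by gcongr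
      _ = 64 * (1 / (ε ^ 2 + ‖x - y‖ ^ 2)) := by field_simp
      _ ≤ 64 * S := by gcongr

lemma tgrad_eq {ε : ℝ} (hε : 0 < ε) {T : Finset (E 4)} {W : E 4 → ℝ} (hT : T.Nonempty)
    (hW : ∀ y ∈ T, 0 < W y) (hT1 : ∀ y ∈ T, ‖y‖ = 1) (x : E 4) (hx : ‖x‖ = 1) :
    tgradNormSq 4 (uf ε T W) x = ‖gradient (uf ε T W) x‖ ^ 2 := by
  rw [tgradNormSq, uf_radial hε hT hW hT1 x hx]; ring

lemma tgrad_nonneg {ε : ℝ} (hε : 0 < ε) {T : Finset (E 4)} {W : E 4 → ℝ} (hT : T.Nonempty)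
    (hW : ∀ y ∈ T, 0 < W y) (hT1 : ∀ y ∈ T, ‖y‖ = 1) :
    ∀ᵐ x ∂(sphMeasure 4), 0 ≤ tgradNormSq 4 (uf ε T W) x := by
  filter_upwards [sph_ae] with x hx
  rw [tgrad_eq hε hT hW hT1 x hx]; positivity

lemma tgrad_integral {ε : ℝ} (hε : 0 < ε) {T : Finset (E 4)} {W : E 4 → ℝ} (hT : T.Nonempty)
    (hW : ∀ y ∈ T, 0 < W y) (hT1 : ∀ y ∈ T, ‖y‖ = 1) :
    ∫ x, tgradNormSq 4 (uf ε T W) x ∂(sphMeasure 4) ≤ 256 * (T.card * (2 * Real.pi ^ 2 + 128)) := by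
  have h1 : ∫ x, tgradNormSq 4 (uf ε T W) x ∂(sphMeasure 4) ≤
      ∫ x, 256 * ∑ y ∈ T, 1 / (ε ^ 2 + ‖x - y‖ ^ 2) ∂(sphMeasure 4) := by
    refine integral_mono_of_nonneg (tgrad_nonneg hε hT hW hT1)
      (sph_integrable (continuous_const.mul (sum_q_cont hε T))) ?_
    filter_upwards [sph_ae] with x hx
    rw [tgrad_eq hε hT hW hT1 x hx, grad_sq, Fin.sum_univ_four]
    have := fderiv_sq_bound hε hT hW hT1 x hx.le
    linarith [this 0, this 1, this 2, this 3]
  refine h1.trans ?_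
  rw [integral_const_mul]
  have := sum_q_integral hε T hT1
  linarith

lemma exp_lower {ε : ℝ} (hε : 0 < ε) (hε1 : ε ≤ 1) {T : Finset (E 4)} {W : E 4 → ℝ} 
    (hW : ∀ y ∈ T, 0 < W y) (hT1 : ∀ y ∈ T, ‖y‖ = 1) (κ : E 4) (hκ : κ ∈ T) :
    W κ / 512 * (1 / ε) ^ 3 ≤ ∫ x, Real.exp (3 * uf ε T W x) ∂(sphMeasure 4) := by
  have hT : T.Nonempty := ⟨κ, hκ⟩
  have hi : Integrable (fun x => Real.exp (3 * uf ε T W x)) (sphMeasure 4) := by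
    refine sph_integrable ?_
    have := (uf_smooth hε hT hW).continuous
    fun_prop
  set s : Set (E 4) := {x | ‖x - κ‖ < ε} with hs
  have hsm : MeasurableSet s := cap_meas κ ε
  have h1 : ∫ x in s, Real.exp (3 * uf ε T W x) ∂(sphMeasure 4) ≤ ∫ x, Real.exp (3 * uf ε T W x) ∂(sphMeasure 4) :=
    setIntegral_le_integral hi (Eventually.of_forall fun x => (Real.exp_pos _).le)
  refine le_trans ?_ h1
  have hWκ := hW κ hκ
  have hc : ∫ x in s, W κ * ((2 * ε ^ 2) ^ 3)⁻¹ ∂(sphMeasure 4) ≤ ∫ x in s, Real.exp (3 * uf ε T W x) ∂(sphMeasure 4) := by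
    refine setIntegral_mono_on_ae (integrable_const _) hi.integrableOn hsm ?_
    filter_upwards [sph_ae] with x hx hxs
    rw [exp_uf hε hT hW]
    have hxs' : ‖x - κ‖ < ε := hxs
    refine le_trans ?_ (Finset.single_le_sum (f := fun y => W y * (Af ε y x ^ 3)⁻¹) (fun y hy => ?_) hκ)
    · have hA : Af ε κ x ≤ 2 * ε ^ 2 := by
        rw [Af, sfun_sphere κ x hx]
        nlinarith [norm_nonneg (x - κ)]
      have := Af_pos hε κ x
      gcongr
    · have := hW y hy
      have := Af_pos hε y x
      positivity
  refine le_trans ?_ hc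
  rw [setIntegral_const, smul_eq_mul]
  have h2 : ε ^ 3 / 64 ≤ (sphMeasure 4).real s := by
    rw [measureReal_def, ← ENNReal.ofReal_le_iff_le_toReal (measure_ne_top _ _)]
    exact cap_lower κ (hT1 κ hκ) ε hε hε1
  calc W κ / 512 * (1 / ε) ^ 3 = ε ^ 3 / 64 * (W κ * ((2 * ε ^ 2) ^ 3)⁻¹) := by field_simp; ring
    _ ≤ _ := by gcongr

lemma lap_integral {T : Finset (E 4)} {W : E 4 → ℝ} (hT : T.Nonempty)
    (hW : ∀ y ∈ T, 0 < W y) (hs : ∑ y ∈ T, W y = 1) (hT1 : ∀ y ∈ T, ‖y‖ = 1) (η : ℝ) (hη : 0 < η)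
    (hη1 : η ≤ 1) : ∃ C : ℝ, ∀ ε : ℝ, 0 < ε → ε ≤ 1 → 
      ∫ x in ball (0 : E 4) 1, (lap 4 (uf ε T W) x) ^ 2 ≤
        Real.pi ^ 2 * T.card * ((1 + η) * (4 + 40 * η) ^ 2) * Real.log (1 / ε) + C := by
  obtain ⟨C, hC, h⟩ := lap_bound hT hW hs hT1 η hη hη1
  set K := (1 + η) * (4 + 40 * η) ^ 2
  have hK : 0 ≤ K := by positivity
  refine ⟨C * (Real.pi ^ 2 / 2) + T.card * (Real.pi ^ 2 * (2 * K + 1000)), fun ε hε hε1 => ?_⟩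
  have hcont : ∀ y : E 4, Continuous fun x : E 4 => K / (ε ^ 2 + ‖x - y‖ ^ 2) ^ 2
        + 1000 * ε ^ 2 / (ε ^ 2 + ‖x - y‖ ^ 2) ^ 3 := fun y =>
    (continuous_const.div (by fun_prop) fun x => by positivity).add
      (continuous_const.div (by fun_prop) fun x => by positivity)
  have h_integ : ∀ {F : E 4 → ℝ}, Continuous F → IntegrableOn F (ball 0 1) := fun hF =>
    (hF.continuousOn.integrableOn_compact (isCompact_closedBall 0 1)).mono_set ball_subset_closedBall
  have h1 : ∫ x in ball (0 : E 4) 1, (lap 4 (uf ε T W) x) ^ 2 ≤ ∫ x in ball (0 : E 4) 1,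
      (C + ∑ y ∈ T, (K / (ε ^ 2 + ‖x - y‖ ^ 2) ^ 2 + 1000 * ε ^ 2 / (ε ^ 2 + ‖x - y‖ ^ 2) ^ 3)) := by
    refine integral_mono_of_nonneg (Eventually.of_forall fun x => sq_nonneg _)
      (h_integ (continuous_const.add (continuous_finsetSum _ fun y _ => hcont y))) ?_
    filter_upwards [ae_restrict_mem measurableSet_ball] with x hx
    exact h ε hε hε1 x (by simpa using (mem_ball_zero_iff.1 hx).le)
  refine h1.trans ?_
  rw [integral_add (h_integ continuous_const) (h_integ (continuous_finsetSum _ fun y _ => hcont y)),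
    integral_finsetSum _ fun y _ => h_integ (hcont y), setIntegral_const, vol_ball4, smul_eq_mul]
  have h2 := Finset.sum_le_sum fun y hy => ball_bound y (hT1 y hy) ε K 1000 hε hε1 hK (by norm_num)
  rw [Finset.sum_const, nsmul_eq_mul] at h2
  linarith

lemma config_finset (m N : ℕ) (x : Fin N → E 4) (w : Fin N → ℝ) (hx : ∀ i, x i ∈ sphere (0 : E 4) 1)
    (hw : ∀ i, 0 ≤ w i) (hs : ∑ i, w i = 1)
    (hq : ∀ p ∈ P0 4 m, (∑ i, w i * MvPolynomial.eval (fun j => x i j) p) = 0) :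
    ∃ (T : Finset (E 4)) (W : E 4 → ℝ), T.Nonempty ∧ (∀ y ∈ T, 0 < W y) ∧ ∑ y ∈ T, W y = 1 ∧
      (∀ y ∈ T, ‖y‖ = 1) ∧ T.card ≤ N ∧
      ∀ p ∈ P0 4 m, ∑ y ∈ T, W y * MvPolynomial.eval (fun j => y j) p = 0 := by
  classical
  set S := Finset.univ.filter fun i => 0 < w i with hS
  set T := S.image x with hTdef
  set W : E 4 → ℝ := fun y => ∑ i ∈ S with x i = y, w i with hW
  have key : ∀ F : E 4 → ℝ, ∑ y ∈ T, W y * F y = ∑ i, w i * F (x i) := by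
    intro F
    have h1 : ∑ i ∈ S, w i * F (x i) = ∑ i, w i * F (x i) := by
      refine Finset.sum_subset (Finset.subset_univ _) fun i _ hi => ?_
      have : w i = 0 := le_antisymm (by simpa [hS] using hi) (hw i)
      rw [this, zero_mul]
    rw [← h1, ← Finset.sum_fiberwise_of_maps_to (t := T) (g := x)
      fun i hi => Finset.mem_image_of_mem x hi]
    refine Finset.sum_congr rfl fun y _ => ?_
    rw [hW, Finset.sum_mul]
    refine Finset.sum_congr rfl fun i hi => ?_
    rw [(Finset.mem_filter.1 hi).2]
  have hsum : ∑ y ∈ T, W y = 1 := by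
    have := key fun _ => 1
    simpa [hs] using this
  refine ⟨T, W, ?_, ?_, hsum, ?_, ?_, ?_⟩
  · by_contra hne
    rw [Finset.not_nonempty_iff_eq_empty] at hne
    rw [hne] at hsum; simp at hsum
  · intro y hy
    obtain ⟨i, hi, rfl⟩ := Finset.mem_image.1 hy
    refine Finset.sum_pos (fun j hj => ?_) ⟨i, Finset.mem_filter.2 ⟨hi, rfl⟩⟩
    exact (Finset.mem_filter.1 (Finset.mem_filter.1 hj).1).2
  · intro y hy
    obtain ⟨i, hi, rfl⟩ := Finset.mem_image.1 hy
    simpa using hx i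
  · refine Finset.card_image_le.trans ((Finset.card_le_univ _).trans (by simp))
  · intro p hp
    rw [key fun y => MvPolynomial.eval (fun j => y j) p]
    exact hq p hp

lemma uf_constr (m : ℕ) {ε : ℝ} (hε : 0 < ε) {T : Finset (E 4)} {W : E 4 → ℝ} (hT : T.Nonempty)
    (hW : ∀ y ∈ T, 0 < W y) (hT1 : ∀ y ∈ T, ‖y‖ = 1)
    (hquad : ∀ p ∈ P0 4 m, ∑ y ∈ T, W y * MvPolynomial.eval (fun j => y j) p = 0) :
    ∀ p ∈ P0 4 m,
        ∫ x, MvPolynomial.eval (fun i => x i) p * Real.exp (3 * uf ε T W x) ∂(sphMeasure 4) = 0 := by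
  intro p hp
  rw [← constr m T W hT1 hquad (fun t => ((ε ^ 2 + t) ^ 3)⁻¹) ?_ p hp]
  · refine integral_congr_ae ?_
    filter_upwards [sph_ae] with x hx
    rw [exp_uf hε hT hW]
    simp only [Phi, Af, sfun_sphere _ x hx]
  · exact Continuous.inv₀ (by fun_prop) fun x => by positivity

/-- The inequality assumed in the theorem. -/
def MainHyp (m : ℕ) (a b : ℝ) : Prop :=
  ∀ f u : E 4 → ℝ, ContDiff ℝ (⊤ : ℕ∞) f → ContDiff ℝ (⊤ : ℕ∞) u →
      (∀ p ∈ P0 4 m,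
        ∫ x, MvPolynomial.eval (fun i => x i) p * Real.exp (3 * f x) ∂(sphMeasure 4) = 0) →
      (∀ x ∈ Metric.sphere (0 : E 4) 1, u x = f x) →
      (∀ x ∈ Metric.sphere (0 : E 4) 1, fderiv ℝ u x x = 0) →
      Real.log ((1 / (2 * Real.pi ^ 2)) *
          ∫ x, Real.exp (3 * (f x - (1 / (2 * Real.pi ^ 2)) * ∫ y, f y ∂(sphMeasure 4)))
            ∂(sphMeasure 4)) ≤
        a * ((∫ x in Metric.ball (0 : E 4) 1, (lap 4 u x) ^ 2) +
              2 * ∫ x, tgradNormSq 4 f x ∂(sphMeasure 4)) + b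

lemma log_lower {ε : ℝ} (hε : 0 < ε) (hε1 : ε ≤ 1) {T : Finset (E 4)} {W : E 4 → ℝ} 
    (hW : ∀ y ∈ T, 0 < W y) (hs : ∑ y ∈ T, W y = 1) (hT1 : ∀ y ∈ T, ‖y‖ = 1) (κ : E 4) (hκ : κ ∈ T) :
    3 * Real.log (1 / ε) + Real.log (1 / (2 * Real.pi ^ 2) * (W κ / 512))
      - 3 * (1 / (2 * Real.pi ^ 2) * (T.card * (2 * Real.pi ^ 2 + 128))) ≤
    Real.log ((1 / (2 * Real.pi ^ 2)) *
          ∫ x, Real.exp (3 * (uf ε T W x - (1 / (2 * Real.pi ^ 2)) * ∫ y, uf ε T W y ∂(sphMeasure 4)))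
            ∂(sphMeasure 4)) := by
  have hT : T.Nonempty := ⟨κ, hκ⟩
  have hπ := Real.pi_pos
  have hWκ := hW κ hκ
  have hm := uf_mean hε hT hW hs hT1
  have hl := exp_lower hε hε1 hW hT1 κ hκ
  set M := ∫ y, uf ε T W y ∂(sphMeasure 4)
  have e1 : ∀ x, Real.exp (3 * (uf ε T W x - (1 / (2 * Real.pi ^ 2)) * M))
      = Real.exp (-(3 * (1 / (2 * Real.pi ^ 2) * M))) * Real.exp (3 * uf ε T W x) := by
    intro x; rw [← Real.exp_add]; congr 1; ring
  simp_rw [e1]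
  rw [integral_const_mul]
  set I := ∫ x, Real.exp (3 * uf ε T W x) ∂(sphMeasure 4)
  set c := 1 / (2 * Real.pi ^ 2) with hc
  have hc0 : 0 < c := by positivity
  have h0 : 0 < W κ / 512 * (1 / ε) ^ 3 := by positivity
  have hI : 0 < I := lt_of_lt_of_le h0 hl
  have e2 : Real.log (c * (Real.exp (-(3 * (c * M))) * I)) = -(3 * (c * M)) + Real.log (c * I) := by
    rw [show c * (Real.exp (-(3 * (c * M))) * I) = Real.exp (-(3 * (c * M))) * (c * I) by ring,
      Real.log_mul (Real.exp_pos _).ne' (by positivity), Real.log_exp]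
  have h3 : Real.log (c * (W κ / 512 * (1 / ε) ^ 3)) ≤ Real.log (c * I) :=
    Real.log_le_log (by positivity) (by gcongr)
  have e3 : Real.log (c * (W κ / 512 * (1 / ε) ^ 3)) = Real.log (c * (W κ / 512)) + 3 * Real.log (1 / ε) := by
    rw [← mul_assoc, Real.log_mul (by positivity) (by positivity), Real.log_pow]; norm_num
  have h4 : c * M ≤ c * (T.card * (2 * Real.pi ^ 2 + 128)) := by gcongr
  rw [e2]; linarith

lemma asymp (K A B : ℝ) (h : ∀ L : ℝ, 0 ≤ L → K * L ≤ A * L + B) : K ≤ A := by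
  by_contra hlt
  push Not at hlt
  have h1 := h ((|B| + 1) / (K - A)) (by have := sub_pos.2 hlt; positivity)
  have h2 : (K - A) * ((|B| + 1) / (K - A)) = |B| + 1 := mul_div_cancel₀ _ (sub_pos.2 hlt).ne'
  have := le_abs_self B
  nlinarith

lemma main_case (m : ℕ) (a b : ℝ) (h : MainHyp m a b) {T : Finset (E 4)} {W : E 4 → ℝ} (hT : T.Nonempty)
    (hW : ∀ y ∈ T, 0 < W y) (hs : ∑ y ∈ T, W y = 1) (hT1 : ∀ y ∈ T, ‖y‖ = 1)
    (hquad : ∀ p ∈ P0 4 m, ∑ y ∈ T, W y * MvPolynomial.eval (fun j => y j) p = 0) :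
    0 ≤ a ∧ 3 ≤ a * (Real.pi ^ 2 * T.card * 16) := by
  obtain ⟨κ, hκ⟩ := hT
  have hT : T.Nonempty := ⟨κ, hκ⟩
  obtain ⟨C1, hC1⟩ : ∃ C1, C1 = Real.log (1 / (2 * Real.pi ^ 2) * (W κ / 512))
      - 3 * (1 / (2 * Real.pi ^ 2) * (T.card * (2 * Real.pi ^ 2 + 128))) := ⟨_, rfl⟩
  have base : ∀ ε : ℝ, 0 < ε → ε ≤ 1 → 3 * Real.log (1 / ε) + C1 ≤
      a * ((∫ x in Metric.ball (0 : E 4) 1, (lap 4 (uf ε T W) x) ^ 2) +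
              2 * ∫ x, tgradNormSq 4 (uf ε T W) x ∂(sphMeasure 4)) + b := by
    intro ε hε hε1
    have h1 := h (uf ε T W) (uf ε T W) (uf_smooth hε hT hW) (uf_smooth hε hT hW)
      (uf_constr m hε hT hW hT1 hquad) (fun _ _ => rfl)
      (fun x hx => uf_radial hε hT hW hT1 x (by simpa using hx))
    have h2 := log_lower hε hε1 hW hs hT1 κ hκ
    linarith
  have en0 : ∀ ε : ℝ, 0 < ε → 0 ≤ (∫ x in Metric.ball (0 : E 4) 1, (lap 4 (uf ε T W) x) ^ 2) +
              2 * ∫ x, tgradNormSq 4 (uf ε T W) x ∂(sphMeasure 4) := by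
    intro ε hε
    have h1 : 0 ≤ ∫ x in Metric.ball (0 : E 4) 1, (lap 4 (uf ε T W) x) ^ 2 :=
      integral_nonneg fun x => sq_nonneg _
    have h2 := integral_nonneg_of_ae (tgrad_nonneg hε hT hW hT1)
    linarith
  have hexp : ∀ L : ℝ, 0 ≤ L → 0 < Real.exp (-L) ∧ Real.exp (-L) ≤ 1 ∧ Real.log (1 / Real.exp (-L)) = L := by
    intro L hL
    refine ⟨Real.exp_pos _, by simpa using hL, ?_⟩
    rw [one_div, ← Real.exp_neg, neg_neg, Real.log_exp]
  have ha : 0 ≤ a := by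
    by_contra hlt
    push Not at hlt
    have := asymp 3 0 (b - C1) fun L hL => by
      obtain ⟨g1, g2, g3⟩ := hexp L hL
      have h1 := base _ g1 g2
      have h2 := mul_nonpos_of_nonpos_of_nonneg hlt.le (en0 _ g1)
      rw [g3] at h1
      linarith
    linarith
  refine ⟨ha, ?_⟩
  have step : ∀ η : ℝ, 0 < η → η ≤ 1 → 3 ≤ a * (Real.pi ^ 2 * T.card * ((1 + η) * (4 + 40 * η) ^ 2)) := by
    intro η hη hη1
    obtain ⟨C, hC⟩ := lap_integral hT hW hs hT1 η hη hη1
    refine asymp 3 _ (a * (C + 2 * (256 * (T.card * (2 * Real.pi ^ 2 + 128)))) + b - C1) fun L hL => ?_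
    obtain ⟨g1, g2, g3⟩ := hexp L hL
    have h1 := base _ g1 g2
    have h2 := hC _ g1 g2
    have h3 := tgrad_integral g1 hT hW hT1
    rw [g3] at h1 h2
    have h4 := mul_le_mul_of_nonneg_left (add_le_add h2 (mul_le_mul_of_nonneg_left h3 (zero_le_two (α := ℝ)))) ha
    linarith
  have hlim : Tendsto (fun η : ℝ => a * (Real.pi ^ 2 * T.card * ((1 + η) * (4 + 40 * η) ^ 2)))
      (nhdsWithin 0 (Set.Ioi 0)) (nhds (a * (Real.pi ^ 2 * T.card * 16))) := by
    have hc : Continuous fun η : ℝ => a * (Real.pi ^ 2 * T.card * ((1 + η) * (4 + 40 * η) ^ 2)) := by fun_prop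
    have := (hc.tendsto 0).mono_left (nhdsWithin_le_nhds (s := Set.Ioi 0))
    convert this using 2
    norm_num
  refine ge_of_tendsto hlim ?_
  filter_upwards [Ioc_mem_nhdsGT (zero_lt_one (α := ℝ))] with η hη
  exact step η hη.1 hη.2

/-- Auxiliary function vanishing to second order on the sphere. -/
def vf (t : ℝ) (x : E 4) : ℝ := t * (1 - ‖x‖ ^ 2) ^ 2

lemma nsq_smooth : ContDiff ℝ (⊤ : ℕ∞) fun x : E 4 => ‖x‖ ^ 2 := contDiff_id.norm_sq ℝ

lemma vf_smooth (t : ℝ) : ContDiff ℝ (⊤ : ℕ∞) (vf t) :=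
  contDiff_const.mul ((contDiff_const.sub nsq_smooth).pow 2)

lemma vf_fderiv (t : ℝ) (x v : E 4) : fderiv ℝ (vf t) x v = -4 * t * ((1 - ‖x‖ ^ 2) * ⟪x, v⟫) := by
  refine fderiv_of_line ((vf_smooth t).differentiable (by simp) x) ?_
  have := ((((line_hasDeriv x v 0).norm_sq.const_sub 1).pow 2).const_mul t)
  refine this.congr_deriv ?_
  simp
  ring

lemma vf_fderiv2 (t : ℝ) (x v : E 4) : fderiv ℝ (fun z => fderiv ℝ (vf t) z v) x v =
    -4 * t * ((1 - ‖x‖ ^ 2) * ⟪v, v⟫ - 2 * ⟪x, v⟫ ^ 2) := by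
  simp_rw [vf_fderiv]
  refine fderiv_of_line ?_ ?_
  · have h4 : ContDiff ℝ (⊤ : ℕ∞) fun x : E 4 => ⟪x, v⟫ := contDiff_id.inner ℝ contDiff_const
    exact (contDiff_const.mul ((contDiff_const.sub nsq_smooth).mul h4)).differentiable (by simp) x
  have h4 : HasDerivAt (fun s : ℝ => ⟪x + s • v, v⟫) ⟪v, v⟫ 0 := by
    simpa using (line_hasDeriv x v 0).inner ℝ (hasDerivAt_const 0 v)
  have := ((((line_hasDeriv x v 0).norm_sq.const_sub 1).mul h4).const_mul (-4 * t))
  refine this.congr_deriv ?_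
  simp only [zero_smul, add_zero]
  ring

lemma vf_lap (t : ℝ) (x : E 4) : lap 4 (vf t) x = t * (24 * ‖x‖ ^ 2 - 16) := by
  have h3 : ∀ i, ⟪ev i, ev i⟫ = (1:ℝ) := by intro i; simp [ev]
  have h : lap 4 (vf t) x = ∑ i, -4 * t * ((1 - ‖x‖ ^ 2) * ⟪ev i, ev i⟫ - 2 * ⟪x, ev i⟫ ^ 2) :=
    Finset.sum_congr rfl fun i _ => vf_fderiv2 t x (ev i)
  rw [h, Fin.sum_univ_four]
  simp only [h3, inner_ev]
  rw [nsq]; ring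

lemma vf_int_pos : 0 < ∫ x in ball (0 : E 4) 1, (24 * ‖x‖ ^ 2 - 16) ^ 2 := by
  have h_integ : ∀ r : ℝ, ∀ {F : E 4 → ℝ}, Continuous F → IntegrableOn F (ball 0 r) := fun r _ hF =>
    (hF.continuousOn.integrableOn_compact (isCompact_closedBall 0 r)).mono_set ball_subset_closedBall
  have hc : Continuous fun x : E 4 => (24 * ‖x‖ ^ 2 - 16) ^ 2 := by fun_prop
  have h1 : ∫ x in ball (0 : E 4) (1/2), (24 * ‖x‖ ^ 2 - 16) ^ 2 ≤ ∫ x in ball (0 : E 4) 1, (24 * ‖x‖ ^ 2 - 16) ^ 2 :=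
    setIntegral_mono_set (h_integ 1 hc) (Eventually.of_forall fun x => sq_nonneg _)
      (ball_subset_ball (by norm_num)).eventuallyLE
  refine lt_of_lt_of_le ?_ h1
  have h2 : ∫ x in ball (0 : E 4) (1/2), (1:ℝ) ≤ ∫ x in ball (0 : E 4) (1/2), (24 * ‖x‖ ^ 2 - 16) ^ 2 := by
    refine setIntegral_mono_on (h_integ _ continuous_const) (h_integ _ hc) measurableSet_ball fun x hx => ?_
    have := mem_ball_zero_iff.1 hx
    have h0 := norm_nonneg x
    have : ‖x‖ ^ 2 ≤ 1 / 4 := by nlinarith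
    nlinarith
  refine lt_of_lt_of_le ?_ h2
  rw [setIntegral_const, smul_eq_mul, mul_one]
  exact ENNReal.toReal_pos (measure_ball_pos _ _ (by norm_num)).ne' measure_ball_lt_top.ne

lemma a_nonneg (m : ℕ) (a b : ℝ) (h : MainHyp m a b) : 0 ≤ a := by
  set K := ∫ x in ball (0 : E 4) 1, (24 * ‖x‖ ^ 2 - 16) ^ 2 with hK
  have hK0 : 0 < K := vf_int_pos
  have hall : ∀ t : ℝ, 0 ≤ a * (t ^ 2 * K) + b := by
    intro t
    have h1 := h (fun _ => 0) (vf t) contDiff_const (vf_smooth t) ?_ ?_ ?_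
    · have e1 : ∀ x, tgradNormSq 4 (fun _ => 0) x = 0 := by
        intro x; simp [tgradNormSq, gradient]
      have e2 : ∫ x in ball (0 : E 4) 1, (lap 4 (vf t) x) ^ 2 = t ^ 2 * K := by
        rw [hK, ← integral_const_mul]
        congr 1; ext x; rw [vf_lap]; ring
      have e3 : Real.log ((1 / (2 * Real.pi ^ 2)) *
          ∫ x : E 4, Real.exp (3 * ((0:ℝ) - (1 / (2 * Real.pi ^ 2)) * ∫ y : E 4, (0:ℝ) ∂(sphMeasure 4)))
            ∂(sphMeasure 4)) = 0 := by
        simp only [integral_zero, mul_zero, sub_zero, Real.exp_zero, integral_const, smul_eq_mul, mul_one, sph_univ]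
        rw [one_div_mul_cancel (by positivity), Real.log_one]
      simp only [e1, e2, integral_zero, mul_zero, add_zero] at h1
      rw [← e3]
      simpa using h1
    · intro p hp
      simpa using hp.2
    · intro x hx
      have : ‖x‖ = 1 := by simpa using hx
      simp [vf, this]
    · intro x hx
      have : ‖x‖ = 1 := by simpa using hx
      simp [vf_fderiv, this]
  have := asymp 0 (a * K) b fun L hL => by
    have := hall (Real.sqrt L)
    rw [Real.sq_sqrt hL] at this
    linarith
  by_contra hlt
  push Not at hlt
  nlinarith

theorem stmt6 (m : ℕ) (a b : ℝ)
    (h : ∀ f u : E 4 → ℝ, ContDiff ℝ (⊤ : ℕ∞) f → ContDiff ℝ (⊤ : ℕ∞) u →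
      (∀ p ∈ P0 4 m,
        ∫ x, MvPolynomial.eval (fun i => x i) p * Real.exp (3 * f x) ∂(sphMeasure 4) = 0) →
      (∀ x ∈ Metric.sphere (0 : E 4) 1, u x = f x) →
      (∀ x ∈ Metric.sphere (0 : E 4) 1, fderiv ℝ u x x = 0) →
      Real.log ((1 / (2 * Real.pi ^ 2)) *
          ∫ x, Real.exp (3 * (f x - (1 / (2 * Real.pi ^ 2)) * ∫ y, f y ∂(sphMeasure 4)))
            ∂(sphMeasure 4)) ≤
        a * ((∫ x in Metric.ball (0 : E 4) 1, (lap 4 u x) ^ 2) +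
              2 * ∫ x, tgradNormSq 4 f x ∂(sphMeasure 4)) + b) :
    3 / (16 * Real.pi ^ 2 * (Nsph 4 m : ℝ)) ≤ a := by
  have hM : MainHyp m a b := h
  have ha := a_nonneg m a b hM
  by_cases hN : Nsph 4 m = 0
  · rw [hN]; simpa using ha
  have hne : {N : ℕ | ∃ (x : Fin N → E 4) (w : Fin N → ℝ),
    (∀ i, x i ∈ Metric.sphere (0 : E 4) 1) ∧ (∀ i, 0 ≤ w i) ∧ (∑ i, w i) = 1 ∧
    ∀ p ∈ P0 4 m, (∑ i, w i * MvPolynomial.eval (fun j => x i j) p) = 0}.Nonempty :=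
    Nat.nonempty_of_pos_sInf (Nat.pos_of_ne_zero hN)
  obtain ⟨x, w, hx, hw, hs, hq⟩ := Nat.sInf_mem hne
  obtain ⟨T, W, hT, hW, hsW, hT1, hcard, hquad⟩ := config_finset m _ x w hx hw hs hq
  have hc : (T.card : ℝ) ≤ (Nsph 4 m : ℝ) := by exact_mod_cast hcard
  have h3 := (main_case m a b hM hT hW hsW hT1 hquad).2
  have hNp : (0:ℝ) < Nsph 4 m := by exact_mod_cast Nat.pos_of_ne_zero hN
  have hπ := Real.pi_pos
  rw [div_le_iff₀ (by positivity)]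
  have : a * (Real.pi ^ 2 * T.card * 16) ≤ a * (Real.pi ^ 2 * (Nsph 4 m : ℝ) * 16) := by gcongr
  linarith
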